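/- arXiv:1108.6037 — 2 statements merged into one kernel-verified Lean document; each statement's English description precedes it below -/
import Mathlib

section
/- Let H be of type (p,p) with G(H) = ⟨c⟩, and suppose there is a surjective Hopf algebra map π: H → T_q onto a Taft algebra of dimension p². If D is a simple subcoalgebra of H of dimension p², then left multiplication by c permutes nontrivially either the simple right D-subcomodules of D or the simple left D-subcomodules of D. -/
open TensorProduct

namespace HopfClass

variable (k : Type*) [Field k]

section Wrt

variable {M : Type*} [AddCommGroup M] [Module k M]

/-- A subspace `C` is a subcoalgebra with respect to a comultiplication-like map `Δ`
if `Δ` maps `C` into the image of `C ⊗ C` in `M ⊗ M`. -/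
def IsSubcoalgWrt (Δ : M →ₗ[k] M ⊗[k] M) (C : Submodule k M) : Prop :=
  ∀ x ∈ C, Δ x ∈ LinearMap.range (TensorProduct.map C.subtype C.subtype)

/-- A simple subcoalgebra: a nonzero subcoalgebra with no nonzero proper subcoalgebras. -/
def IsSimpleSubcoalgWrt (Δ : M →ₗ[k] M ⊗[k] M) (C : Submodule k M) : Prop :=
  IsSubcoalgWrt k Δ C ∧ C ≠ ⊥ ∧
    ∀ D : Submodule k M, IsSubcoalgWrt k Δ D → D < C → D = ⊥

/-- Pointedness: every simple subcoalgebra is one-dimensional. -/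
def IsPointedWrt (Δ : M →ₗ[k] M ⊗[k] M) : Prop :=
  ∀ C : Submodule k M, IsSimpleSubcoalgWrt k Δ C → Module.finrank k C = 1

/-- Grouplike element with respect to `Δ`. -/
def IsGrouplikeWrt (Δ : M →ₗ[k] M ⊗[k] M) (g : M) : Prop :=
  g ≠ 0 ∧ Δ g = g ⊗ₜ[k] g

/-- `y` is a `(h, g)`-skew-primitive with respect to `Δ`, i.e. `Δ y = g ⊗ y + y ⊗ h`. -/
def IsSkewPrimitiveWrt (Δ : M →ₗ[k] M ⊗[k] M) (g h y : M) : Prop :=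
  Δ y = g ⊗ₜ[k] y + y ⊗ₜ[k] h

/-- There are no nontrivial skew-primitive elements: every skew-primitive between grouplikes
is a scalar multiple of the difference of the grouplikes. -/
def HasNoNontrivialSkewPrimitivesWrt (Δ : M →ₗ[k] M ⊗[k] M) : Prop :=
  ∀ g h y : M, IsGrouplikeWrt k Δ g → IsGrouplikeWrt k Δ h →
    IsSkewPrimitiveWrt k Δ g h y → ∃ c : k, y = c • (g - h)

end Wrt

section Coalg

variable (H : Type*) [AddCommGroup H] [Module k H] [Coalgebra k H]

/-- The comultiplication of a coalgebra, as a linear map. -/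
noncomputable abbrev comulL : H →ₗ[k] H ⊗[k] H := CoalgebraStruct.comul

/-- The coradical of a coalgebra: the sum of all its simple subcoalgebras. -/
noncomputable def coradical : Submodule k H :=
  sSup {C : Submodule k H | IsSimpleSubcoalgWrt k (comulL k H) C}

/-- A coalgebra is cosemisimple if it equals its coradical. -/
def IsCosemisimple : Prop := coradical k H = ⊤

/-- A coalgebra is pointed if all its simple subcoalgebras are one-dimensional. -/
def IsPointed : Prop := IsPointedWrt k (comulL k H)

/-- The set of grouplike elements. -/
def grouplikes : Set H := {g : H | IsGrouplikeWrt k (comulL k H) g}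

/-- `e` is a multiplicative matrix of size `n` spanning the subspace `C`, i.e. a
linearly independent family with `Δ(e i j) = ∑ l, e i l ⊗ e l j` and `ε(e i j) = δ_ij`
whose span is `C`; this says precisely that `C` is a simple matrix subcoalgebra
isomorphic to `M*(n,k)`, the dual of the `n × n` matrix algebra. -/
def IsMultMatrix (n : ℕ) (C : Submodule k H) (e : Fin n → Fin n → H) : Prop :=
  LinearIndependent k (fun p : Fin n × Fin n => e p.1 p.2) ∧
  C = Submodule.span k (Set.range fun p : Fin n × Fin n => e p.1 p.2) ∧
  (∀ i j, CoalgebraStruct.comul (R := k) (e i j) = ∑ l : Fin n, e i l ⊗ₜ[k] e l j) ∧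
  (∀ i j, Coalgebra.counit (R := k) (e i j) = if i = j then (1 : k) else 0)

/-- `C` is a (simple matrix) subcoalgebra isomorphic to the matrix coalgebra `M*(n,k)`. -/
def IsMatrixSubcoalg (n : ℕ) (C : Submodule k H) : Prop :=
  ∃ e : Fin n → Fin n → H, IsMultMatrix k H n C e

end Coalg

section Dual

variable (H : Type*) [Ring H] [Algebra k H] [FiniteDimensional k H]

/-- The comultiplication on the dual of a finite-dimensional algebra:
the dual map of the multiplication, composed with the canonical identification
`(H ⊗ H)* ≃ H* ⊗ H*`. -/
noncomputable def dualComul :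
    Module.Dual k H →ₗ[k] Module.Dual k H ⊗[k] Module.Dual k H :=
  (TensorProduct.dualDistribEquiv k H H).symm.toLinearMap ∘ₗ
    (LinearMap.mul' k H).dualMap

/-- A finite-dimensional Hopf algebra is copointed if its dual is pointed. -/
def IsCopointed : Prop := IsPointedWrt k (dualComul k H)

/-- The grouplike elements of the dual Hopf algebra. -/
def dualGrouplikes : Set (Module.Dual k H) :=
  {f : Module.Dual k H | IsGrouplikeWrt k (dualComul k H) f}

end Dual

section Taft

variable (p : ℕ) (q : k)

/-- `B` is (isomorphic to) the Taft Hopf algebra `T_q` of dimension `p²`: `q` is a primitive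
`p`-th root of unity, `B` has dimension `p²` and is generated as an algebra by a grouplike `g`
and a `(1,g)`-skew-primitive `x` with `g^p = 1`, `x^p = 0` and `g x = q x g`. -/
def IsTaftAlgebra (B : Type*) [Ring B] [Bialgebra k B] : Prop :=
  IsPrimitiveRoot q p ∧ Module.finrank k B = p ^ 2 ∧
  ∃ g x : B,
    IsGrouplikeWrt k (comulL k B) g ∧
    CoalgebraStruct.comul (R := k) x = x ⊗ₜ[k] (1 : B) + g ⊗ₜ[k] x ∧
    g ^ p = 1 ∧ x ^ p = 0 ∧ g * x = q • (x * g) ∧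
    Algebra.adjoin k {g, x} = (⊤ : Subalgebra k B)

variable {H : Type*} [Ring H] [Bialgebra k H]

/-- The subalgebra `T` of `H` is a sub-Hopf algebra isomorphic to the Taft algebra `T_q` of
dimension `p²`, generated by a grouplike `g` and a `(1,g)`-skew-primitive `x` satisfying the
Taft relations. -/
def IsTaftSubalgebra (T : Subalgebra k H) : Prop :=
  IsPrimitiveRoot q p ∧ Module.finrank k T = p ^ 2 ∧
  ∃ g x : H,
    IsGrouplikeWrt k (comulL k H) g ∧
    CoalgebraStruct.comul (R := k) x = x ⊗ₜ[k] (1 : H) + g ⊗ₜ[k] x ∧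
    g ^ p = 1 ∧ x ^ p = 0 ∧ g * x = q • (x * g) ∧
    Algebra.adjoin k {g, x} = T

/-- The right coinvariants `H^{co π}` of a linear map `π : H → B` on a bialgebra `H`:
elements `h` with `(id ⊗ π)(Δ h) = h ⊗ 1`. -/
def rightCoinvariants {B : Type*} [Ring B] [Bialgebra k B] (π : H →ₗ[k] B) : Set H :=
  {h : H | (TensorProduct.map LinearMap.id π) (CoalgebraStruct.comul (R := k) h)
      = h ⊗ₜ[k] (1 : B)}

end Taft

end HopfClass

section LinearAlgebra

variable {k V W : Type*} [Field k] [AddCommGroup V] [Module k V] [FiniteDimensional k V]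
  [AddCommGroup W] [Module k W] [FiniteDimensional k W]

/-- The space of linear maps intertwining the endomorphisms `M` and `N`. -/
def intertwiners {k V W : Type*} [Field k] [AddCommGroup V] [Module k V] [AddCommGroup W]
    [Module k W] (N : Module.End k W) (M : Module.End k V) : Submodule k (V →ₗ[k] W) where
  carrier := {g | N ∘ₗ g = g ∘ₗ M}
  add_mem' {a b} ha hb := by
    change N ∘ₗ (a + b) = (a + b) ∘ₗ M
    rw [LinearMap.comp_add, LinearMap.add_comp]
    exact congrArg₂ _ ha hb
  zero_mem' := by
    change N ∘ₗ 0 = 0 ∘ₗ M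
    simp
  smul_mem' r a ha := by
    change N ∘ₗ (r • a) = (r • a) ∘ₗ M
    rw [LinearMap.comp_smul, LinearMap.smul_comp]
    exact congrArg (r • ·) ha

/-- If the eigenspaces of `N` have dimension at most `m`, then maps intertwining `M` and `N` and
vanishing on an `M`-stable subspace `X` form a space of dimension at most `m * codim X`. -/
theorem finrank_intertwiners_vanishing_le [IsAlgClosed k] (N : Module.End k W)
    (M : Module.End k V) (m : ℕ) (hm : ∀ μ : k, Module.finrank k (LinearMap.ker (N - μ • 1)) ≤ m)
    (X : Submodule k V) (hX : X ≤ X.comap M) (A : Submodule k (V →ₗ[k] W))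
    (hA : ∀ g ∈ A, N ∘ₗ g = g ∘ₗ M) (hAX : ∀ g ∈ A, ∀ x ∈ X, g x = 0) :
    Module.finrank k A ≤ Module.finrank k (V ⧸ X) * m := by
  induction hd : Module.finrank k (V ⧸ X) generalizing X A with
  | zero =>
    have hXtop : X = ⊤ := by
      rw [← Submodule.Quotient.subsingleton_iff]
      exact Module.finrank_zero_iff.mp hd
    have : A = ⊥ := by
      rw [eq_bot_iff]
      intro g hg
      rw [Submodule.mem_bot]
      ext v
      exact hAX g hg v (hXtop ▸ Submodule.mem_top)
    simp [this]
  | succ d ih =>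
    have hnt : Nontrivial (V ⧸ X) := Module.nontrivial_of_finrank_pos (R := k) (by omega)
    obtain ⟨μ, hμ⟩ := Module.End.exists_eigenvalue (X.mapQ X M hX)
    obtain ⟨v, hv⟩ := hμ.exists_hasEigenvector
    obtain ⟨x, rfl⟩ := Submodule.Quotient.mk_surjective X v
    have hx : x ∉ X := fun h => hv.2 ((Submodule.Quotient.mk_eq_zero X).mpr h)
    have hMx : M x - μ • x ∈ X := by
      have := hv.apply_eq_smul
      rw [Submodule.mapQ_apply, ← Submodule.Quotient.mk_smul] at this
      exact (Submodule.Quotient.eq X).mp this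
    let X' : Submodule k V := X ⊔ Submodule.span k {x}
    have hX' : X' ≤ X'.comap M := by
      refine sup_le (hX.trans (Submodule.comap_mono le_sup_left)) ?_
      rw [Submodule.span_singleton_le_iff_mem, Submodule.mem_comap]
      have h1 : M x = (M x - μ • x) + μ • x := by abel
      rw [h1]
      exact add_mem (Submodule.mem_sup_left hMx)
        (Submodule.mem_sup_right (Submodule.smul_mem _ _ (Submodule.mem_span_singleton_self x)))
    have hdX' : Module.finrank k (V ⧸ X') = d := by
      have h1 := Submodule.finrank_quotient_add_finrank X
      have h2 := Submodule.finrank_quotient_add_finrank X'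
      have h3 : Module.finrank k X' = Module.finrank k X + 1 := by
        have h4 := Submodule.finrank_sup_add_finrank_inf_eq X (Submodule.span k {x})
        have hx0 : x ≠ 0 := fun h => hx (h ▸ X.zero_mem)
        have h5 : X ⊓ Submodule.span k {x} = ⊥ := by
          rw [← disjoint_iff, Submodule.disjoint_span_singleton' hx0]
          exact hx
        rw [h5, finrank_bot, finrank_span_singleton hx0] at h4
        exact h4
      omega
    let ev : A →ₗ[k] W := (LinearMap.applyₗ x).comp A.subtype
    have hrange : LinearMap.range ev ≤ LinearMap.ker (N - μ • 1) := by
      rintro _ ⟨g, rfl⟩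
      have h1 : N (g.1 x) = g.1 (M x) := LinearMap.congr_fun (hA g.1 g.2) x
      have h2 := hAX g.1 g.2 _ hMx
      rw [map_sub, map_smul, sub_eq_zero] at h2
      simp [ev, h1, h2]
    have hker : Module.finrank k (LinearMap.ker ev) ≤ d * m := by
      have h1 : Module.finrank k ((LinearMap.ker ev).map A.subtype) =
          Module.finrank k (LinearMap.ker ev) :=
        LinearEquiv.finrank_eq (Submodule.equivMapOfInjective _ A.injective_subtype _).symm
      rw [← h1]
      refine ih X' hX' _ ?_ ?_ hdX'
      · rintro _ ⟨g, -, rfl⟩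
        exact hA g.1 g.2
      · rintro _ ⟨g, hg, rfl⟩ y hy
        obtain ⟨a, ha, b, hb, rfl⟩ := Submodule.mem_sup.mp hy
        obtain ⟨r, rfl⟩ := Submodule.mem_span_singleton.mp hb
        have h2 : g.1 x = 0 := hg
        simp [hAX g.1 g.2 a ha, h2]
    have h1 := LinearMap.finrank_range_add_finrank_ker ev
    have h2 := (Submodule.finrank_mono hrange).trans (hm μ)
    rw [← h1]
    linarith

/-- The dimension of the space of maps intertwining `M` and `N`, in the presence of a
large cyclic `M`-stable subspace. -/
theorem finrank_intertwiners_le_of_cyclic [IsAlgClosed k] (N : Module.End k W)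
    (M : Module.End k V) (m p : ℕ)
    (hm : ∀ μ : k, Module.finrank k (LinearMap.ker (N - μ • 1)) ≤ m)
    (v : V) (hp : LinearIndependent k (fun i : Fin p => (M ^ (i : ℕ)) v)) :
    Module.finrank k (intertwiners N M) ≤
      Module.finrank k W + (Module.finrank k V - p) * m := by
  have hA : ∀ g ∈ intertwiners N M, N ∘ₗ g = g ∘ₗ M := fun g hg => hg
  let X : Submodule k V := Submodule.span k (Set.range fun i : ℕ => (M ^ i) v)
  have hX : X ≤ X.comap M := by
    rw [Submodule.span_le]
    rintro _ ⟨i, rfl⟩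
    refine Submodule.subset_span ⟨i + 1, ?_⟩
    simp [pow_succ']
  have hpX : p ≤ Module.finrank k X := by
    have h1 := finrank_span_eq_card hp
    rw [Fintype.card_fin] at h1
    rw [← h1]
    refine Submodule.finrank_mono (Submodule.span_mono ?_)
    rintro _ ⟨i, rfl⟩
    exact ⟨i, rfl⟩
  let ev : intertwiners N M →ₗ[k] W := (LinearMap.applyₗ v).comp (intertwiners N M).subtype
  have hker : Module.finrank k (LinearMap.ker ev) ≤ Module.finrank k (V ⧸ X) * m := by
    have h1 : Module.finrank k ((LinearMap.ker ev).map (intertwiners N M).subtype) =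
        Module.finrank k (LinearMap.ker ev) :=
      LinearEquiv.finrank_eq (Submodule.equivMapOfInjective _ (intertwiners N M).injective_subtype _).symm
    rw [← h1]
    refine finrank_intertwiners_vanishing_le N M m hm X hX _ ?_ ?_
    · rintro _ ⟨g, -, rfl⟩
      exact hA g.1 g.2
    · rintro _ ⟨g, hg, rfl⟩
      have h2 : g.1 v = 0 := hg
      have h3 : ∀ i : ℕ, g.1 ((M ^ i) v) = (N ^ i) (g.1 v) := by
        intro i
        induction i with
        | zero => simp
        | succ i ih =>
          have h4 := LinearMap.congr_fun (hA g.1 g.2) ((M ^ i) v)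
          simp only [LinearMap.comp_apply] at h4
          rw [pow_succ', pow_succ', Module.End.mul_apply, Module.End.mul_apply, ← h4, ih]
      intro x hx
      have h5 : X ≤ LinearMap.ker g.1 := by
        rw [Submodule.span_le]
        rintro _ ⟨i, rfl⟩
        simp [h3, h2]
      exact h5 hx
  have h1 := LinearMap.finrank_range_add_finrank_ker ev
  have h2 := Submodule.finrank_le (LinearMap.range ev)
  have h3 := Submodule.finrank_quotient_add_finrank X
  have h4 : Module.finrank k (V ⧸ X) * m ≤ (Module.finrank k V - p) * m :=
    Nat.mul_le_mul_right _ (by omega)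
  omega

theorem linearIndependent_pow_apply_of_nilpotent {k V : Type*} [Field k] [AddCommGroup V]
    [Module k V] (N : Module.End k V) (p : ℕ) (v : V)
    (hN : N ^ p = 0) (hv : (N ^ (p - 1)) v ≠ 0) :
    LinearIndependent k (fun i : Fin p => (N ^ (i : ℕ)) v) := by
  rw [Fintype.linearIndependent_iff]
  intro a ha
  by_contra! h
  obtain ⟨i0, hi0⟩ := h
  obtain ⟨i, hi, hmin⟩ := exists_minimal_of_wellFoundedLT (fun i : Fin p => a i ≠ 0) ⟨i0, hi0⟩
  have h1 := congrArg (N ^ (p - 1 - (i : ℕ))) ha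
  rw [map_sum, map_zero, Finset.sum_eq_single i] at h1
  · rw [map_smul, ← Module.End.mul_apply, ← pow_add,
      show p - 1 - (i : ℕ) + i = p - 1 by omega] at h1
    exact (smul_ne_zero hi hv) h1
  · intro j _ hj
    by_cases haj : a j = 0
    · simp [haj]
    · have hij : i < j := lt_of_le_of_ne (not_lt.mp fun hlt => hlt.not_ge (hmin haj hlt.le)) hj.symm
      rw [map_smul, ← Module.End.mul_apply, ← pow_add,
        pow_eq_zero_of_le (show p ≤ p - 1 - (i : ℕ) + j by omega) hN]
      simp
  · simp

end LinearAlgebra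

section ConvolutionBounds

variable {k H : Type*} [Field k] [Ring H] [HopfAlgebra k H]

open Coalgebra WithConv

/-- Convolution with the identity on the right, as an endomorphism of the space of linear
endomorphisms of a Hopf algebra. -/
noncomputable def convIdRight (k H : Type*) [Field k] [Ring H] [HopfAlgebra k H] :
    (H →ₗ[k] H) →ₗ[k] (H →ₗ[k] H) where
  toFun f := (toConv f * toConv LinearMap.id).ofConv
  map_add' f g := by
    rw [toConv_add, add_mul]; rfl
  map_smul' r f := by
    rw [toConv_smul, smul_mul_assoc]; rfl

/-- Convolution with the identity on the left, as an endomorphism of the space of linear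
endomorphisms of a Hopf algebra. -/
noncomputable def convIdLeft (k H : Type*) [Field k] [Ring H] [HopfAlgebra k H] :
    (H →ₗ[k] H) →ₗ[k] (H →ₗ[k] H) where
  toFun f := (toConv LinearMap.id * toConv f).ofConv
  map_add' f g := by
    rw [toConv_add, mul_add]; rfl
  map_smul' r f := by
    rw [toConv_smul, mul_smul_comm]; rfl

theorem convIdRight_apply {ι : Type*} (f : H →ₗ[k] H) {a : H} (r : Coalgebra.Repr k a ι) :
    convIdRight k H f a = ∑ i ∈ r.index, f (r.left i) * r.right i :=
  r.convMul_apply (toConv f) (toConv LinearMap.id)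

theorem convIdLeft_apply {ι : Type*} (f : H →ₗ[k] H) {a : H} (r : Coalgebra.Repr k a ι) :
    convIdLeft k H f a = ∑ i ∈ r.index, r.left i * f (r.right i) :=
  r.convMul_apply (toConv LinearMap.id) (toConv f)

theorem convIdRight_injective : Function.Injective (convIdRight k H) := by
  intro f g h
  have h1 : toConv f * toConv LinearMap.id = toConv g * toConv LinearMap.id :=
    ofConv_injective h
  have h2 := congrArg (· * toConv (HopfAlgebra.antipode k (A := H))) h1
  simp only [mul_assoc] at h2
  rw [LinearMap.id_mul_antipode, mul_one, mul_one] at h2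
  exact toConv_injective h2

theorem convIdLeft_injective : Function.Injective (convIdLeft k H) := by
  intro f g h
  have h1 : toConv LinearMap.id * toConv f = toConv LinearMap.id * toConv g :=
    ofConv_injective h
  have h2 := congrArg (toConv (HopfAlgebra.antipode k (A := H)) * ·) h1
  simp only [← mul_assoc] at h2
  rw [LinearMap.antipode_mul_id, one_mul, one_mul] at h2
  exact toConv_injective h2

end ConvolutionBounds

section FreenessBounds

variable {k H : Type*} [Field k] [IsAlgClosed k] [Ring H] [HopfAlgebra k H] [FiniteDimensional k H]

open Coalgebra

/-- A nilpotent colinear skew derivation of a Hopf algebra with a Jordan block of size `p` has a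
kernel of dimension at most `dim H / p`. -/
theorem mul_finrank_ker_skewDerivation_le (N Γ : Module.End k H) (p : ℕ)
    (hder : ∀ a b, N (a * b) = N a * Γ b + a * N b)
    (hcol : comul ∘ₗ N = LinearMap.lTensor H N ∘ₗ comul (R := k))
    (hnil : N ^ p = 0) (v : H) (hv : (N ^ (p - 1)) v ≠ 0) :
    p * Module.finrank k (LinearMap.ker N) ≤ Module.finrank k H := by
  have hli := linearIndependent_pow_apply_of_nilpotent N p v hnil hv
  have hpn : p ≤ Module.finrank k H := by simpa using hli.fintype_card_le_finrank
  have hm : ∀ μ : k, Module.finrank k (LinearMap.ker (N - μ • 1)) ≤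
      Module.finrank k (LinearMap.ker N) := by
    intro μ
    by_cases hμ : μ = 0
    · rw [hμ, zero_smul, sub_zero]
    · have : LinearMap.ker (N - μ • 1) = ⊥ := by
        rw [LinearMap.ker_eq_bot']
        intro x hx
        have h1 : N x = μ • x := by simpa [sub_eq_zero] using hx
        have h2 : ∀ i : ℕ, (N ^ i) x = μ ^ i • x := by
          intro i
          induction i with
          | zero => simp
          | succ i ih => rw [pow_succ', Module.End.mul_apply, ih, map_smul, h1, smul_smul, pow_succ]
        have h3 := h2 p
        rw [hnil, LinearMap.zero_apply] at h3
        exact (smul_eq_zero.mp h3.symm).resolve_left (pow_ne_zero _ hμ)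
      rw [this, finrank_bot]
      exact Nat.zero_le _
  have hup := finrank_intertwiners_le_of_cyclic N N _ p hm v hli
  let Φ : (H →ₗ[k] LinearMap.ker N) →ₗ[k] (H →ₗ[k] H) :=
    convIdRight k H ∘ₗ LinearMap.compRight k (LinearMap.ker N).subtype
  have hΦ : Function.Injective Φ := by
    refine convIdRight_injective.comp ?_
    intro f g hfg
    ext x
    exact LinearMap.congr_fun hfg x
  have hΦA : LinearMap.range Φ ≤ intertwiners N N := by
    rintro _ ⟨f, rfl⟩
    change N ∘ₗ Φ f = Φ f ∘ₗ N
    ext a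
    let r := ℛ k a
    let r' : Coalgebra.Repr k (N a) (H × H) :=
      ⟨r.index, r.left, fun i => N (r.right i), by
        have h1 := LinearMap.congr_fun hcol a
        simp only [LinearMap.comp_apply] at h1
        rw [h1, ← r.eq, map_sum]
        rfl⟩
    have h1 := convIdRight_apply ((LinearMap.ker N).subtype ∘ₗ f) r
    have h2 := convIdRight_apply ((LinearMap.ker N).subtype ∘ₗ f) r'
    change N (convIdRight k H ((LinearMap.ker N).subtype ∘ₗ f) a) =
      convIdRight k H ((LinearMap.ker N).subtype ∘ₗ f) (N a)
    rw [h1, h2, map_sum]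
    refine Finset.sum_congr rfl fun i _ => ?_
    rw [hder]
    simp [r']
  have hlow := Submodule.finrank_mono hΦA
  rw [LinearMap.finrank_range_of_inj hΦ, Module.finrank_linearMap] at hlow
  have h1 := hlow.trans hup
  obtain ⟨t, ht⟩ := Nat.exists_eq_add_of_le hpn
  rw [ht] at h1 ⊢
  rw [Nat.add_sub_cancel_left] at h1
  nlinarith

/-- If the first `p` powers of a grouplike element `c` are linearly independent, then the space
of elements fixed by left multiplication by `c` has dimension at most `dim H / p`. -/
theorem mul_finrank_fixed_mulLeft_le (c : H) (p : ℕ) (hc : IsGroupLikeElem k c)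
    (hli : LinearIndependent k (fun i : Fin p => c ^ (i : ℕ))) :
    p * Module.finrank k (LinearMap.ker (LinearMap.mulLeft k c - 1)) ≤ Module.finrank k H := by
  have hpn : p ≤ Module.finrank k H := by simpa using hli.fintype_card_le_finrank
  let d : k → ℕ := fun μ => Module.finrank k (LinearMap.ker (LinearMap.mulLeft k c - μ • 1))
  obtain ⟨χ, hχ⟩ : ∃ χ, ∀ μ, d μ ≤ d χ := by
    have hbdd : BddAbove (Set.range d) := by
      refine ⟨Module.finrank k H, ?_⟩
      rintro _ ⟨μ, rfl⟩
      exact Submodule.finrank_le _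
    obtain ⟨χ, hχ⟩ := Nat.sSup_mem (Set.range_nonempty d) hbdd
    exact ⟨χ, fun μ => hχ ▸ le_csSup hbdd ⟨μ, rfl⟩⟩
  suffices h : p * d χ ≤ Module.finrank k H by
    have h1 := hχ 1
    have h2 : LinearMap.mulLeft k c - (1 : k) • 1 = LinearMap.mulLeft k c - 1 := by
      rw [one_smul]
    simp only [d] at h1 h
    rw [h2] at h1
    exact (Nat.mul_le_mul_left p h1).trans h
  by_cases hχ0 : χ = 0
  · have : d χ = 0 := by
      have h1 : LinearMap.ker (LinearMap.mulLeft k c - χ • 1) = ⊥ := by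
        rw [LinearMap.ker_eq_bot']
        intro x hx
        rw [hχ0, zero_smul, sub_zero, LinearMap.mulLeft_apply] at hx
        exact (hc.isUnit.mul_right_eq_zero).mp hx
      simp [d, h1]
    simp [this]
  let M : Module.End k H := LinearMap.mulLeft k c
  have hm : ∀ μ : k, Module.finrank k (LinearMap.ker (χ • M - μ • 1)) ≤ d χ := by
    intro μ
    have h1 : χ • M - μ • 1 = χ • (M - (χ⁻¹ * μ) • 1) := by
      rw [smul_sub, smul_smul, mul_inv_cancel_left₀ hχ0]
    rw [h1, LinearMap.ker_smul _ _ hχ0]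
    exact hχ _
  have hli' : LinearIndependent k (fun i : Fin p => (M ^ (i : ℕ)) (1 : H)) := by
    have : (fun i : Fin p => (M ^ (i : ℕ)) (1 : H)) = fun i : Fin p => c ^ (i : ℕ) := by
      funext i
      simp [M, LinearMap.pow_mulLeft]
    rwa [this]
  have hup := finrank_intertwiners_le_of_cyclic (χ • M) M _ p hm 1 hli'
  let R := LinearMap.range (M - χ • 1)
  let Φ : ((H ⧸ R) →ₗ[k] H) →ₗ[k] (H →ₗ[k] H) :=
    convIdLeft k H ∘ₗ LinearMap.lcomp k H R.mkQ
  have hΦ : Function.Injective Φ := by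
    refine convIdLeft_injective.comp ?_
    intro f g hfg
    exact LinearMap.cancel_right (Submodule.mkQ_surjective R) |>.mp hfg
  have hΦA : LinearMap.range Φ ≤ intertwiners (χ • M) M := by
    rintro _ ⟨f, rfl⟩
    change (χ • M) ∘ₗ Φ f = Φ f ∘ₗ M
    ext a
    let r := ℛ k a
    let r' : Coalgebra.Repr k (c * a) (H × H) :=
      ⟨r.index, fun i => c * r.left i, fun i => c * r.right i, by
        rw [Bialgebra.comul_mul, hc.comul_eq_tmul_self, ← r.eq, Finset.mul_sum]
        simp⟩
    have h1 := convIdLeft_apply (f ∘ₗ R.mkQ) r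
    have h2 := convIdLeft_apply (f ∘ₗ R.mkQ) r'
    change χ • (c * convIdLeft k H (f ∘ₗ R.mkQ) a) = convIdLeft k H (f ∘ₗ R.mkQ) (c * a)
    rw [h1, h2, Finset.mul_sum, Finset.smul_sum]
    refine Finset.sum_congr rfl fun i _ => ?_
    have h3 : R.mkQ (c * r.right i) = χ • R.mkQ (r.right i) := by
      rw [← map_smul, ← sub_eq_zero, ← map_sub, Submodule.mkQ_apply,
        Submodule.Quotient.mk_eq_zero]
      exact ⟨r.right i, by simp [M]⟩
    simp only [r', LinearMap.comp_apply, h3, map_smul, mul_smul_comm, mul_assoc]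
  have hlow := Submodule.finrank_mono hΦA
  have hR : Module.finrank k (H ⧸ R) = d χ := by
    have h1 := LinearMap.finrank_range_add_finrank_ker (M - χ • 1)
    have h2 := Submodule.finrank_quotient_add_finrank R
    change Module.finrank k R + d χ = _ at h1
    omega
  rw [LinearMap.finrank_range_of_inj hΦ, Module.finrank_linearMap, hR] at hlow
  have h1 := hlow.trans hup
  obtain ⟨t, ht⟩ := Nat.exists_eq_add_of_le hpn
  rw [ht] at h1 ⊢
  rw [Nat.add_sub_cancel_left] at h1
  nlinarith

end FreenessBounds

section RightHit

variable {k H B : Type*} [Field k] [Ring H] [Bialgebra k H] [Ring B] [Bialgebra k B]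

open Coalgebra

/-- The action `a ↦ ∑ ψ(a₂) a₁` of a functional `ψ` on a coalgebra. -/
noncomputable def rightHit {k H : Type*} [Field k] [AddCommGroup H] [Module k H] [Coalgebra k H]
    (ψ : H →ₗ[k] k) : Module.End k H :=
  (TensorProduct.rid k H).toLinearMap ∘ₗ LinearMap.lTensor H ψ ∘ₗ comul

theorem rightHit_apply_of_comul {ι : Type*} (s : Finset ι) (ψ : H →ₗ[k] k) (a : H) (x y : ι → H)
    (h : comul (R := k) a = ∑ i ∈ s, x i ⊗ₜ[k] y i) :
    rightHit ψ a = ∑ i ∈ s, ψ (y i) • x i := by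
  simp [rightHit, h]

theorem rightHit_apply_repr {ι : Type*} (ψ : H →ₗ[k] k) {a : H} (r : Coalgebra.Repr k a ι) :
    rightHit ψ a = ∑ i ∈ r.index, ψ (r.right i) • r.left i :=
  rightHit_apply_of_comul _ ψ a _ _ r.eq.symm

theorem rightHit_apply_grouplike (ψ : H →ₗ[k] k) {a : H} (h : comul (R := k) a = a ⊗ₜ[k] a) :
    rightHit ψ a = ψ a • a := by
  simp [rightHit, h]

theorem comul_comp_rightHit (ψ : H →ₗ[k] k) :
    comul ∘ₗ rightHit ψ = LinearMap.lTensor H (rightHit ψ) ∘ₗ comul (R := k) := by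
  have h1 : comul ∘ₗ (TensorProduct.rid k H).toLinearMap ∘ₗ LinearMap.lTensor H ψ =
      LinearMap.lTensor H ((TensorProduct.rid k H).toLinearMap ∘ₗ LinearMap.lTensor H ψ) ∘ₗ
        (TensorProduct.assoc k H H H).toLinearMap ∘ₗ LinearMap.rTensor H comul := by
    ext a b
    have h2 : ∀ z : H ⊗[k] H, ψ b • z =
        LinearMap.lTensor H ((TensorProduct.rid k H).toLinearMap ∘ₗ LinearMap.lTensor H ψ)
          (TensorProduct.assoc k H H H (z ⊗ₜ[k] b)) := by
      intro z
      induction z with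
      | zero => simp
      | tmul x y => simp
      | add x y hx hy => rw [smul_add, hx, hy, TensorProduct.add_tmul, map_add, map_add]
    simpa using h2 (comul a)
  ext a
  have h2 := LinearMap.congr_fun h1 (comul a)
  simp only [LinearMap.comp_apply, LinearEquiv.coe_coe, coassoc_apply] at h2
  simp only [LinearMap.comp_apply, LinearEquiv.coe_coe, rightHit, h2, LinearMap.lTensor_comp]

theorem counit_rightHit (ψ : H →ₗ[k] k) (a : H) : counit (R := k) (rightHit ψ a) = ψ a := by
  let r := ℛ k a
  rw [rightHit_apply_repr ψ r, map_sum]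
  conv_rhs => rw [← sum_counit_smul r, map_sum]
  refine Finset.sum_congr rfl fun i _ => ?_
  rw [map_smul, map_smul, smul_eq_mul, smul_eq_mul, mul_comm]

theorem rightHit_mul (ψ φ χ : H →ₗ[k] k) (h : ∀ a b, ψ (a * b) = φ a * χ b) (a b : H) :
    rightHit ψ (a * b) = rightHit φ a * rightHit χ b := by
  let r := ℛ k a
  let s := ℛ k b
  have h1 : comul (R := k) (a * b) = ∑ i ∈ r.index ×ˢ s.index,
      (r.left i.1 * s.left i.2) ⊗ₜ[k] (r.right i.1 * s.right i.2) := by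
    rw [Bialgebra.comul_mul, ← r.eq, ← s.eq, Finset.sum_mul_sum, Finset.sum_product]
    simp
  rw [rightHit_apply_of_comul _ ψ _ _ _ h1, rightHit_apply_repr φ r, rightHit_apply_repr χ s,
    Finset.sum_mul_sum, Finset.sum_product]
  refine Finset.sum_congr rfl fun i _ => Finset.sum_congr rfl fun j _ => ?_
  rw [h, smul_mul_smul_comm]

theorem rightHit_counit : rightHit (counit : H →ₗ[k] k) = LinearMap.id := by
  ext a
  simp [rightHit]

theorem rightHit_skewDerivation (ν φ : H →ₗ[k] k)
    (h : ∀ a b, ν (a * b) = ν a * φ b + counit a * ν b) (a b : H) :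
    rightHit ν (a * b) = rightHit ν a * rightHit φ b + a * rightHit ν b := by
  let r := ℛ k a
  let s := ℛ k b
  have h1 : comul (R := k) (a * b) = ∑ i ∈ r.index ×ˢ s.index,
      (r.left i.1 * s.left i.2) ⊗ₜ[k] (r.right i.1 * s.right i.2) := by
    rw [Bialgebra.comul_mul, ← r.eq, ← s.eq, Finset.sum_mul_sum, Finset.sum_product]
    simp
  have h2 : a = rightHit (counit : H →ₗ[k] k) a := by simp [rightHit_counit]
  conv_rhs => enter [2, 1]; rw [h2]
  rw [rightHit_apply_of_comul _ ν _ _ _ h1, rightHit_apply_repr φ s, rightHit_apply_repr ν r,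
    rightHit_apply_repr counit r, rightHit_apply_repr ν s, Finset.sum_mul_sum, Finset.sum_mul_sum,
    Finset.sum_product, ← Finset.sum_add_distrib]
  refine Finset.sum_congr rfl fun i _ => ?_
  rw [← Finset.sum_add_distrib]
  refine Finset.sum_congr rfl fun j _ => ?_
  rw [h, smul_mul_smul_comm, smul_mul_smul_comm, ← add_smul]

theorem map_rightHit (π : H →ₐc[k] B) (ψ : B →ₗ[k] k) (a : H) :
    π (rightHit (ψ ∘ₗ (π : H →ₗ[k] B)) a) = rightHit ψ (π a) := by
  let r := ℛ k a
  have h1 : comul (R := k) (π a) = ∑ i ∈ r.index, π (r.left i) ⊗ₜ[k] π (r.right i) := by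
    rw [← CoalgHomClass.map_comp_comul_apply π a, ← r.eq, map_sum]
    rfl
  rw [rightHit_apply_of_comul _ ψ _ _ _ h1, rightHit_apply_repr _ r, map_sum]
  simp

/-- A colinear endomorphism vanishes as soon as it induces zero along a bialgebra map. -/
theorem eq_zero_of_colinear_of_map_eq_zero (π : H →ₐc[k] B) (P : Module.End k H)
    (hP : comul ∘ₗ P = LinearMap.lTensor H P ∘ₗ comul (R := k)) (h : ∀ a, π (P a) = 0) : P = 0 := by
  ext a
  have h1 : (counit : H →ₗ[k] k) ∘ₗ P = 0 := by
    ext b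
    simp [← CoalgHomClass.counit_comp_apply π (P b), h]
  have h2 := LinearMap.congr_fun hP a
  simp only [LinearMap.comp_apply] at h2
  have h3 := lTensor_counit_comul (R := k) (P a)
  rw [h2, ← LinearMap.comp_apply, ← LinearMap.lTensor_comp, h1, LinearMap.lTensor_zero] at h3
  have h4 := congrArg (TensorProduct.rid k H) h3
  simpa using h4.symm

end RightHit

section Grouplike

variable {k H : Type*} [Field k] [Ring H] [Bialgebra k H]

open HopfClass

theorem isGrouplikeWrt_comulL_iff {g : H} :
    IsGrouplikeWrt k (comulL k H) g ↔ IsGroupLikeElem k g := by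
  refine ⟨fun ⟨hg0, hg⟩ => ⟨?_, hg⟩, fun hg => ⟨fun h => ?_, hg.comul_eq_tmul_self⟩⟩
  · have h1 := Coalgebra.rTensor_counit_comul (R := k) g
    change CoalgebraStruct.comul (R := k) g = _ at hg
    rw [hg, LinearMap.rTensor_tmul] at h1
    have h2 := congrArg (TensorProduct.lid k H) h1
    simp only [TensorProduct.lid_tmul, one_smul] at h2
    exact smul_left_injective k hg0 (h2.trans (one_smul k g).symm)
  · have h1 := hg.counit_eq_one
    rw [h, map_zero] at h1
    exact zero_ne_one h1

end Grouplike

section Taft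

variable {k B : Type*} [Field k] [Ring B]

section Algebra

variable [Algebra k B] {p : ℕ} {r : k} {g x : B}

theorem pow_mul_pow_of_skewCommute (hxg : x * g = r • (g * x)) (j m : ℕ) :
    x ^ j * g ^ m = r ^ (j * m) • (g ^ m * x ^ j) := by
  have h1 : ∀ m : ℕ, x * g ^ m = r ^ m • (g ^ m * x) := by
    intro m
    induction m with
    | zero => simp
    | succ m ih =>
      rw [pow_succ, ← mul_assoc, ih, smul_mul_assoc, mul_assoc, hxg, mul_smul_comm, smul_smul,
        ← mul_assoc, ← pow_succ]
  induction j with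
  | zero => simp
  | succ j ih =>
    rw [pow_succ', mul_assoc, ih, mul_smul_comm, ← mul_assoc, h1, smul_mul_assoc, smul_smul,
      mul_assoc, ← pow_add, Nat.succ_mul]

theorem span_monomials_eq_top_of_skewCommute (hp : 0 < p) (hxg : x * g = r • (g * x))
    (hg : g ^ p = 1) (hx : x ^ p = 0) (hadj : Algebra.adjoin k {g, x} = (⊤ : Subalgebra k B)) :
    Submodule.span k (Set.range fun ij : Fin p × Fin p => g ^ (ij.1 : ℕ) * x ^ (ij.2 : ℕ)) = ⊤ := by
  set S := Submodule.span k (Set.range fun ij : Fin p × Fin p => g ^ (ij.1 : ℕ) * x ^ (ij.2 : ℕ))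
    with hS
  have hmem : ∀ i j : ℕ, g ^ i * x ^ j ∈ S := by
    intro i j
    by_cases hj : j < p
    · refine Submodule.subset_span ⟨(⟨i % p, Nat.mod_lt _ hp⟩, ⟨j, hj⟩), ?_⟩
      simp only [← pow_eq_pow_mod i hg]
    · rw [pow_eq_zero_of_le (not_lt.mp hj) hx, mul_zero]
      exact S.zero_mem
  have hstable : ∀ a b, b ∈ S → a * b ∈ S := by
    intro a
    have ha : a ∈ Algebra.adjoin k {g, x} := hadj ▸ Algebra.mem_top
    induction ha using Algebra.adjoin_induction with
    | mem y hy =>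
      intro b hb
      have hle : S ≤ S.comap (LinearMap.mulLeft k y) := by
        rw [hS, Submodule.span_le, ← hS]
        rintro _ ⟨ij, rfl⟩
        rcases hy with rfl | rfl
        · simpa [← mul_assoc, ← pow_succ'] using hmem (ij.1 + 1) ij.2
        · have h1 := pow_mul_pow_of_skewCommute hxg 1 ij.1
          rw [pow_one] at h1
          change y * (g ^ (ij.1 : ℕ) * y ^ (ij.2 : ℕ)) ∈ S
          rw [← mul_assoc, h1, smul_mul_assoc, mul_assoc, ← pow_succ']
          exact S.smul_mem _ (hmem _ _)
      exact hle hb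
    | algebraMap c =>
      intro b hb
      rw [← Algebra.smul_def]
      exact S.smul_mem c hb
    | add y z _ _ hy hz =>
      intro b hb
      rw [add_mul]
      exact S.add_mem (hy b hb) (hz b hb)
    | mul y z _ _ hy hz =>
      intro b hb
      rw [mul_assoc]
      exact hy _ (hz b hb)
  rw [eq_top_iff]
  intro a _
  simpa using hstable a 1 (by simpa using hmem 0 0)

end Algebra

open Coalgebra HopfClass in
/-- The functionals on a Taft algebra dual to its generators, and the endomorphisms through which
they act. -/
theorem exists_functionals_of_isTaftAlgebra [IsAlgClosed k] [HopfAlgebra k B] {p : ℕ} {q : k}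
    (hp : p.Prime) (hB : IsTaftAlgebra k p q B) :
    ∃ ν φ : B →ₗ[k] k, φ 1 = 1 ∧ (∀ a b, φ (a * b) = φ a * φ b) ∧
      (∀ a b, ν (a * b) = ν a * φ b + counit a * ν b) ∧
      rightHit ν ^ p = 0 ∧ (∃ v, (rightHit ν ^ (p - 1)) v ≠ 0) ∧
      rightHit φ ∘ₗ rightHit ν = q⁻¹ • (rightHit ν ∘ₗ rightHit φ) ∧
      ∀ (μ : k) (b b' : B), rightHit ν b = 0 → rightHit ν b' = 0 → rightHit φ b = μ • b →
        rightHit φ b' = μ • b' → b ≠ 0 → ∃ s : k, b' = s • b := by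
  obtain ⟨hq, hdim, g, x, ⟨hg0, hΔg⟩, hΔx, hgp, hxp, hgx, hadj⟩ := hB
  have hp1 := hp.one_lt
  have hnt : Nontrivial B := ⟨g, 0, hg0⟩
  have hq0 : q ≠ 0 := hq.ne_zero hp.ne_zero
  have hr := hq.inv
  generalize hrq : q⁻¹ = r at hr ⊢
  have hxg : x * g = r • (g * x) := by rw [hgx, smul_smul, ← hrq, inv_mul_cancel₀ hq0, one_smul]
  have hfin : FiniteDimensional k B := .of_finrank_pos (hdim ▸ pow_pos hp.pos 2)
  let b : Module.Basis (Fin p × Fin p) k B :=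
    basisOfTopLeSpanOfCardEqFinrank (fun ij => g ^ (ij.1 : ℕ) * x ^ (ij.2 : ℕ))
      (span_monomials_eq_top_of_skewCommute hp.pos hxg hgp hxp hadj).ge
      (by simp [hdim, sq])
  have hb : ∀ ij, b ij = g ^ (ij.1 : ℕ) * x ^ (ij.2 : ℕ) := fun ij => by simp [b]
  let φ : B →ₗ[k] k := b.constr k fun ij => if (ij.2 : ℕ) = 0 then r ^ (ij.1 : ℕ) else 0
  let ν : B →ₗ[k] k := b.constr k fun ij => if (ij.2 : ℕ) = 1 then 1 else 0
  have hφ : ∀ i j : ℕ, φ (g ^ i * x ^ j) = if j = 0 then r ^ i else 0 := by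
    intro i j
    by_cases hj : j < p
    · have h1 := hb (⟨i % p, Nat.mod_lt _ hp.pos⟩, ⟨j, hj⟩)
      simp only [← pow_eq_pow_mod i hgp] at h1
      rw [← h1, b.constr_basis]
      simp only [← pow_eq_pow_mod i hr.pow_eq_one]
    · rw [pow_eq_zero_of_le (not_lt.mp hj) hxp, mul_zero, map_zero, if_neg (by omega)]
  have hν : ∀ i j : ℕ, ν (g ^ i * x ^ j) = if j = 1 then 1 else 0 := by
    intro i j
    by_cases hj : j < p
    · have h1 := hb (⟨i % p, Nat.mod_lt _ hp.pos⟩, ⟨j, hj⟩)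
      simp only [← pow_eq_pow_mod i hgp] at h1
      rw [← h1, b.constr_basis]
    · rw [pow_eq_zero_of_le (not_lt.mp hj) hxp, mul_zero, map_zero, if_neg (by omega)]
  have hεg : counit (R := k) g = 1 :=
    (isGrouplikeWrt_comulL_iff.mp ⟨hg0, hΔg⟩).counit_eq_one
  have hεx : counit (R := k) x = 0 := by
    have h1 := rTensor_counit_comul (R := k) x
    rw [hΔx, map_add, LinearMap.rTensor_tmul, LinearMap.rTensor_tmul, hεg] at h1
    have h2 := congrArg (TensorProduct.lid k B) h1
    simp only [map_add, TensorProduct.lid_tmul, one_smul] at h2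
    have h3 : counit (R := k) x • (1 : B) = 0 := by simpa using h2
    have h4 := congrArg (counit (R := k)) h3
    simpa using h4
  have hε : ∀ i j : ℕ, counit (R := k) (g ^ i * x ^ j) = if j = 0 then 1 else 0 := by
    intro i j
    rw [Bialgebra.counit_mul, Bialgebra.counit_pow, Bialgebra.counit_pow, hεg, hεx, one_pow,
      one_mul, zero_pow_eq]
  have hmono : ∀ i j m n : ℕ, (g ^ i * x ^ j) * (g ^ m * x ^ n) =
      r ^ (j * m) • (g ^ (i + m) * x ^ (j + n)) := by
    intro i j m n
    rw [mul_assoc, ← mul_assoc (x ^ j), pow_mul_pow_of_skewCommute hxg, smul_mul_assoc,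
      mul_smul_comm, mul_assoc, ← mul_assoc, ← pow_add, ← pow_add]
  have hφmul : ∀ a c, φ (a * c) = φ a * φ c := by
    have h1 : (LinearMap.mul k B).compr₂ φ = (LinearMap.mul k k).compl₁₂ φ φ := by
      refine LinearMap.ext_basis b b fun ij mn => ?_
      simp only [LinearMap.compr₂_apply, LinearMap.mul_apply', LinearMap.compl₁₂_apply, hb, hmono,
        map_smul, hφ]
      by_cases hj : (ij.2 : ℕ) = 0 <;> by_cases hn : (mn.2 : ℕ) = 0 <;> simp [hj, hn, pow_add]
    exact fun a c => LinearMap.congr_fun₂ h1 a c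
  have hνmul : ∀ a c, ν (a * c) = ν a * φ c + counit a * ν c := by
    have h1 : (LinearMap.mul k B).compr₂ ν =
        (LinearMap.mul k k).compl₁₂ ν φ + (LinearMap.mul k k).compl₁₂ counit ν := by
      refine LinearMap.ext_basis b b fun ij mn => ?_
      simp only [LinearMap.compr₂_apply, LinearMap.mul_apply', LinearMap.compl₁₂_apply, hb, hmono,
        map_smul, hφ, hν, hε, LinearMap.add_apply]
      rcases Nat.eq_zero_or_pos (ij.2 : ℕ) with hj | hj
      · simp [hj]
      · rw [if_neg hj.ne', zero_mul, add_zero]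
        by_cases hn : (mn.2 : ℕ) = 0
        · by_cases hj1 : (ij.2 : ℕ) = 1 <;> simp [hn, hj1]
        · rw [if_neg (by omega), if_neg hn]
          simp
    exact fun a c => LinearMap.congr_fun₂ h1 a c
  have hφ1 : φ 1 = 1 := by simpa using hφ 0 0
  refine ⟨ν, φ, hφ1, hφmul, hνmul, ?_⟩
  have hΓmul := rightHit_mul φ φ φ hφmul
  have hder := rightHit_skewDerivation ν φ hνmul
  have hcol := comul_comp_rightHit ν
  have hΔgi : ∀ i : ℕ, comul (R := k) (g ^ i) = (g ^ i) ⊗ₜ[k] (g ^ i) := by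
    intro i
    rw [Bialgebra.comul_pow, hΔg, Algebra.TensorProduct.tmul_pow]
  have hΓgi : ∀ i : ℕ, rightHit φ (g ^ i) = r ^ i • g ^ i := by
    intro i
    rw [rightHit_apply_grouplike φ (hΔgi i)]
    congr 1
    simpa using hφ i 0
  have hNgi : ∀ i : ℕ, rightHit ν (g ^ i) = 0 := by
    intro i
    rw [rightHit_apply_grouplike ν (hΔgi i)]
    have h1 : ν (g ^ i) = 0 := by simpa using hν i 0
    rw [h1, zero_smul]
  have hskew : ∀ ψ : B →ₗ[k] k, rightHit ψ x = ψ 1 • x + ψ x • g := by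
    intro ψ
    simp [rightHit, hΔx]
  have hΓx : rightHit φ x = x := by
    have h1 : φ x = 0 := by simpa using hφ 0 1
    rw [hskew, hφ1, h1, one_smul, zero_smul, add_zero]
  have hNx : rightHit ν x = g := by
    have h1 : ν x = 1 := by simpa using hν 0 1
    have h2 : ν 1 = 0 := by simpa using hν 0 0
    rw [hskew, h1, h2, one_smul, zero_smul, zero_add]
  have hΓ : ∀ i j : ℕ, rightHit φ (g ^ i * x ^ j) = r ^ i • (g ^ i * x ^ j) := by
    intro i j
    induction j with
    | zero => rw [pow_zero, mul_one, hΓgi]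
    | succ j ih => rw [pow_succ, ← mul_assoc, hΓmul, ih, hΓx, smul_mul_assoc]
  let t : ℕ → k := fun n => ∑ i ∈ Finset.range n, r ^ i
  have hN : ∀ i j : ℕ, rightHit ν (g ^ i * x ^ j) = t j • (g ^ (i + 1) * x ^ (j - 1)) := by
    intro i j
    induction j with
    | zero => simp [t, hNgi]
    | succ j ih =>
      have h1 : t (j + 1) = t j + r ^ j := Finset.sum_range_succ _ _
      have h2 := pow_mul_pow_of_skewCommute hxg j 1
      rw [pow_one, mul_one] at h2
      rw [pow_succ, ← mul_assoc, hder, ih, hΓx, hNx, mul_assoc, h2, h1, add_smul, smul_mul_assoc,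
        mul_smul_comm, mul_assoc, ← mul_assoc (g ^ i), Nat.add_sub_cancel]
      congr 1
      · rcases j with - | j
        · simp [t]
        · rw [Nat.add_sub_cancel, ← pow_succ]
      · rw [← pow_succ]
  have hNpow : ∀ n i j : ℕ, (rightHit ν ^ n) (g ^ i * x ^ j) =
      (∏ s ∈ Finset.range n, t (j - s)) • (g ^ (i + n) * x ^ (j - n)) := by
    intro n i j
    induction n with
    | zero => simp
    | succ n ih =>
      rw [pow_succ', Module.End.mul_apply, ih, map_smul, hN, smul_smul, Finset.prod_range_succ,
        add_assoc, Nat.sub_sub]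
  have hnil : rightHit ν ^ p = 0 := by
    refine b.ext fun ij => ?_
    rw [hb, hNpow, Finset.prod_eq_zero (Finset.mem_range.mpr ij.2.2) (by simp [t]), zero_smul,
      LinearMap.zero_apply]
  have hgu : IsUnit g := IsUnit.of_pow_eq_one hgp hp.ne_zero
  have ht : ∀ j, 0 < j → j < p → t j ≠ 0 := by
    intro j hj hjp h0
    have h1 : t j * (r - 1) = r ^ j - 1 := geom_sum_mul r j
    rw [h0, zero_mul, eq_comm, sub_eq_zero] at h1
    exact hr.pow_ne_one_of_pos_of_lt hj.ne' hjp h1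
  have hv : (rightHit ν ^ (p - 1)) (x ^ (p - 1)) ≠ 0 := by
    have h1 := hNpow (p - 1) 0 (p - 1)
    rw [pow_zero, one_mul, Nat.sub_self, pow_zero, mul_one, zero_add] at h1
    rw [h1]
    refine smul_ne_zero (Finset.prod_ne_zero_iff.mpr fun s hs => ?_)
      ((hgu.pow _).ne_zero)
    rw [Finset.mem_range] at hs
    exact ht _ (by omega) (by omega)
  refine ⟨hnil, ⟨_, hv⟩, ?_, ?_⟩
  · refine b.ext fun ij => ?_
    simp only [LinearMap.comp_apply, LinearMap.smul_apply, hb, hN, hΓ, map_smul, smul_smul]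
    congr 1
    ring
  · have hdimker : Module.finrank k (LinearMap.ker (rightHit ν)) ≤ p := by
      have h1 := mul_finrank_ker_skewDerivation_le (rightHit ν) (rightHit φ) p hder hcol hnil _ hv
      rw [hdim, sq] at h1
      exact Nat.le_of_mul_le_mul_left h1 hp.pos
    have hli : LinearIndependent k fun i : Fin p => g ^ (i : ℕ) := by
      have h1 := b.linearIndependent.comp (fun i : Fin p => (i, (⟨0, hp.pos⟩ : Fin p)))
        (fun i j hij => congrArg Prod.fst hij)
      convert h1 using 2 with i
      simp [hb]
    have hspan : Submodule.span k (Set.range fun i : Fin p => g ^ (i : ℕ)) =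
        LinearMap.ker (rightHit ν) := by
      refine Submodule.eq_of_le_of_finrank_le ?_ ?_
      · rw [Submodule.span_le]
        rintro _ ⟨i, rfl⟩
        exact hNgi i
      · rw [finrank_span_eq_card hli, Fintype.card_fin]
        exact hdimker
    have hcoef : ∀ (μ : k) (a : B), rightHit ν a = 0 → rightHit φ a = μ • a →
        ∃ s : Fin p → k, a = ∑ i, s i • g ^ (i : ℕ) ∧ ∀ i, s i ≠ 0 → r ^ (i : ℕ) = μ := by
      intro μ a ha ha'
      have h1 : a ∈ Submodule.span k (Set.range fun i : Fin p => g ^ (i : ℕ)) := by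
        rw [hspan]
        exact ha
      obtain ⟨s, rfl⟩ := (Submodule.mem_span_range_iff_exists_fun k).mp h1
      refine ⟨s, rfl, fun i hi => ?_⟩
      rw [map_sum, Finset.smul_sum, ← sub_eq_zero, ← Finset.sum_sub_distrib] at ha'
      have h2 := Fintype.linearIndependent_iff.mp hli (fun i => s i * (r ^ (i : ℕ) - μ)) (by
        rw [← ha']
        refine Finset.sum_congr rfl fun j _ => ?_
        rw [map_smul, hΓgi, smul_smul, smul_smul, ← sub_smul]
        congr 1
        ring) i
      exact sub_eq_zero.mp ((mul_eq_zero.mp h2).resolve_left hi)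
    intro μ a a' ha ha' hΓa hΓa' ha0
    obtain ⟨s, rfl, hs⟩ := hcoef μ a ha hΓa
    obtain ⟨s', rfl, hs'⟩ := hcoef μ a' ha' hΓa'
    obtain ⟨i, hi⟩ : ∃ i, s i ≠ 0 := by
      by_contra! h
      exact ha0 (by simp [h])
    have huniq : ∀ j : Fin p, r ^ (j : ℕ) = μ → j = i := fun j hj =>
      Fin.ext (hr.pow_inj j.2 i.2 (hj.trans (hs i hi).symm))
    have hsingle : ∀ u : Fin p → k, (∀ j, u j ≠ 0 → r ^ (j : ℕ) = μ) →
        ∑ j, u j • g ^ (j : ℕ) = u i • g ^ (i : ℕ) := by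
      intro u hu
      refine Finset.sum_eq_single i (fun j _ hj => ?_) (by simp)
      by_cases huj : u j = 0
      · rw [huj, zero_smul]
      · exact absurd (huniq j (hu j huj)) hj
    refine ⟨s' i / s i, ?_⟩
    rw [hsingle s hs, hsingle s' hs', smul_smul, div_mul_cancel₀ _ hi]

end Taft

section Weights

/-- A multiplicative system of weights attaining a primitive `n`-th root of unity in every row
takes the value `1` only on the diagonal. -/
theorem eq_of_weight_eq_one {k : Type*} [Field k] {n : ℕ} {w : Fin n → Fin n → k} {ω : k}
    (hw : ∀ i l j, w i l * w l j = w i j) (hdiag : ∀ i, w i i = 1) (hω : IsPrimitiveRoot ω n)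
    (hex : ∀ i, ∃ l, w i l = ω) {i j : Fin n} (hij : w i j = 1) : i = j := by
  choose s hs using hex
  have hn : 0 < n := i.pos
  have h1 : ∀ m : ℕ, w i (s^[m] i) = ω ^ m := by
    intro m
    induction m with
    | zero => simp [hdiag]
    | succ m ih => rw [Function.iterate_succ_apply', ← hw i (s^[m] i), ih, hs, pow_succ]
  have hinj : Function.Injective fun m : Fin n => s^[(m : ℕ)] i := by
    intro a b hab
    have h2 : ω ^ (a : ℕ) = ω ^ (b : ℕ) := by
      rw [← h1, ← h1]
      exact congrArg (w i) hab
    exact Fin.ext (hω.pow_inj a.2 b.2 h2)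
  obtain ⟨m, hm⟩ := (Finite.injective_iff_surjective.mp hinj) j
  simp only at hm
  have h2 : ω ^ (m : ℕ) = ω ^ 0 := by rw [← h1, hm, hij, pow_zero]
  rw [hω.pow_inj m.2 hn h2] at hm
  exact hm

theorem eq_zero_of_isNilpotent_of_apply_eq_smul {k V : Type*} [Field k] [AddCommGroup V]
    [Module k V] {N : Module.End k V} (hN : IsNilpotent N) {s : k} {x : V} (hx : x ≠ 0)
    (h : N x = s • x) : s = 0 := by
  obtain ⟨n, hn⟩ := hN
  have h1 : ∀ i : ℕ, (N ^ i) x = s ^ i • x := by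
    intro i
    induction i with
    | zero => simp
    | succ i ih => rw [pow_succ', Module.End.mul_apply, ih, map_smul, h, smul_smul, pow_succ]
  have h2 := h1 n
  rw [hn, LinearMap.zero_apply] at h2
  exact eq_zero_of_pow_eq_zero ((smul_eq_zero.mp h2.symm).resolve_right hx)

/-- Two skew-commuting endomorphisms, the first of which is nilpotent, have a common eigenvector
in every nonzero stable subspace. -/
theorem exists_common_eigenvector {k V : Type*} [Field k] [IsAlgClosed k] [AddCommGroup V]
    [Module k V] [FiniteDimensional k V] {N Γ : Module.End k V} {r : k} (hr : r ≠ 0)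
    (hcomm : Γ ∘ₗ N = r • (N ∘ₗ Γ)) (hN : IsNilpotent N) {U : Submodule k V} (hU : U ≠ ⊥)
    (hUN : U ≤ U.comap N) (hUΓ : U ≤ U.comap Γ) :
    ∃ f ∈ U, f ≠ 0 ∧ N f = 0 ∧ ∃ μ : k, Γ f = μ • f := by
  let K := U ⊓ LinearMap.ker N
  have hK : ∀ f ∈ K, Γ f ∈ K := by
    rintro f ⟨hfU, hfN⟩
    refine ⟨hUΓ hfU, ?_⟩
    have h1 := LinearMap.congr_fun hcomm f
    rw [LinearMap.comp_apply, LinearMap.mem_ker.mp hfN, map_zero] at h1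
    exact (smul_eq_zero.mp h1.symm).resolve_left hr
  have hKnt : Nontrivial K := by
    obtain ⟨u, huU, hu0⟩ := Submodule.exists_mem_ne_zero_of_ne_bot hU
    have hpow : ∀ n, (N ^ n) u ∈ U := by
      intro n
      induction n with
      | zero => simpa using huU
      | succ n ih =>
        rw [pow_succ', Module.End.mul_apply]
        exact hUN ih
    have hex : ∃ n, (N ^ n) u = 0 := by
      obtain ⟨n, hn⟩ := hN
      exact ⟨n, by rw [hn, LinearMap.zero_apply]⟩
    classical
    obtain ⟨n, hn⟩ : ∃ n, Nat.find hex = n + 1 := by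
      refine Nat.exists_eq_succ_of_ne_zero fun h => hu0 ?_
      have := Nat.find_spec hex
      rw [h] at this
      simpa using this
    have h0 : (N ^ n) u ≠ 0 := Nat.find_min hex (by omega)
    have h1 : N ((N ^ n) u) = 0 := by
      have := Nat.find_spec hex
      rwa [hn, pow_succ', Module.End.mul_apply] at this
    exact ⟨⟨⟨(N ^ n) u, hpow n, h1⟩, 0, fun h => h0 (congrArg Subtype.val h)⟩⟩
  obtain ⟨μ, hμ⟩ := Module.End.exists_eigenvalue (Γ.restrict hK)
  obtain ⟨f, hf⟩ := hμ.exists_hasEigenvector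
  exact ⟨f, f.2.1, fun h => hf.2 (Subtype.ext h), f.2.2, μ, congrArg Subtype.val hf.apply_eq_smul⟩

end Weights

section MatrixCoalgebra

variable {k H : Type*} [Field k] [Ring H] {n : ℕ} {e : Fin n → Fin n → H}

open Coalgebra

theorem exists_smul_of_mem_row_of_mem_column [Module k H]
    (hli : LinearIndependent k fun ij : Fin n × Fin n => e ij.1 ij.2) {i j : Fin n} {y : H}
    (hrow : y ∈ Submodule.span k (Set.range (e i)))
    (hcolumn : y ∈ Submodule.span k (Set.range fun l => e l j)) : ∃ s : k, y = s • e i j := by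
  obtain ⟨a, ha⟩ := (Submodule.mem_span_range_iff_exists_fun k).mp hrow
  obtain ⟨b, hb⟩ := (Submodule.mem_span_range_iff_exists_fun k).mp hcolumn
  have h1 := Fintype.linearIndependent_iff.mp hli
    (fun xy => (if xy.1 = i then a xy.2 else 0) - if xy.2 = j then b xy.1 else 0) (by
      simp only [sub_smul, Finset.sum_sub_distrib, ite_smul, zero_smul]
      rw [Fintype.sum_prod_type_right, Fintype.sum_prod_type]
      simp [ha, hb])
  refine ⟨a j, ha.symm.trans (Finset.sum_eq_single j (fun l _ hl => ?_) (by simp))⟩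
  have h2 := h1 (i, l)
  simp only [if_true, if_neg hl, sub_zero] at h2
  rw [h2, zero_smul]

theorem linearIndependent_row [Module k H]
    (hli : LinearIndependent k fun ij : Fin n × Fin n => e ij.1 ij.2) (i : Fin n) :
    LinearIndependent k (e i) :=
  hli.comp (fun j => (i, j)) fun _ _ h => congrArg Prod.snd h

theorem eq_zero_of_smul_row_eq_row [Module k H]
    (hli : LinearIndependent k fun ij : Fin n × Fin n => e ij.1 ij.2) {i i' : Fin n}
    (hii' : i ≠ i') {v w : Fin n → k} (h : ∑ j, v j • e i j = ∑ j, w j • e i' j) (j : Fin n) :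
    v j = 0 := by
  have h1 := Fintype.linearIndependent_iff.mp hli
    (fun xy => (if xy.1 = i then v xy.2 else 0) - if xy.1 = i' then w xy.2 else 0) (by
      simp only [sub_smul, Finset.sum_sub_distrib, ite_smul, zero_smul]
      rw [Fintype.sum_prod_type_right, Fintype.sum_prod_type_right]
      simp [h]) (i, j)
  simpa [hii'] using h1

theorem rightHit_row [Bialgebra k H] (hΔ : ∀ i j, comul (R := k) (e i j) = ∑ l, e i l ⊗ₜ[k] e l j)
    (ψ : H →ₗ[k] k) (i : Fin n) (v : Fin n → k) :
    rightHit ψ (∑ j, v j • e i j) = ∑ l, (∑ j, ψ (e l j) * v j) • e i l := by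
  simp only [map_sum, map_smul, rightHit_apply_of_comul _ ψ _ _ _ (hΔ i _), Finset.smul_sum,
    smul_smul, Finset.sum_smul]
  rw [Finset.sum_comm]
  simp only [mul_comm]

theorem weight_mul_weight [Bialgebra k H]
    (hli : LinearIndependent k fun ij : Fin n × Fin n => e ij.1 ij.2)
    (hΔ : ∀ i j, comul (R := k) (e i j) = ∑ l, e i l ⊗ₜ[k] e l j) {c : H}
    (hc : IsGroupLikeElem k c) {w : Fin n → Fin n → k} (hw : ∀ i j, c * e i j = w i j • e i j)
    (i l j : Fin n) : w i l * w l j = w i j := by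
  have h1 : comul (R := k) (c * e i j) = ∑ l, (w i l * w l j) • (e i l ⊗ₜ[k] e l j) := by
    rw [Bialgebra.comul_mul, hc.comul_eq_tmul_self, hΔ, Finset.mul_sum]
    refine Finset.sum_congr rfl fun l _ => ?_
    rw [Algebra.TensorProduct.tmul_mul_tmul, hw, hw, TensorProduct.smul_tmul_smul]
  rw [hw, map_smul, hΔ, Finset.smul_sum, ← sub_eq_zero, ← Finset.sum_sub_distrib] at h1
  simp only [← sub_smul] at h1
  have h2 : LinearIndependent k fun l => e i l ⊗ₜ[k] e l j :=
    (hli.tmul_of_isDomain hli).comp (fun l => ((i, l), (l, j))) fun _ _ h =>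
      congrArg (fun z => z.1.2) h
  exact (sub_eq_zero.mp (Fintype.linearIndependent_iff.mp h2 _ h1 l)).symm

theorem exists_apply_row_ne_zero [HopfAlgebra k H]
    (hΔ : ∀ i j, comul (R := k) (e i j) = ∑ l, e i l ⊗ₜ[k] e l j)
    (hε : ∀ i j, counit (R := k) (e i j) = if i = j then 1 else 0) (ψ : H →ₗ[k] k)
    (hψ1 : ψ 1 = 1) (hψ : ∀ a b, ψ (a * b) = ψ a * ψ b) (i : Fin n) : ∃ l, ψ (e i l) ≠ 0 := by
  by_contra! h
  let r : Coalgebra.Repr k (e i i) (Fin n) := ⟨Finset.univ, fun l => e i l, fun l => e l i,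
    (hΔ i i).symm⟩
  have h1 := HopfAlgebra.sum_mul_antipode_eq_algebraMap_counit r
  have h2 := congrArg ψ h1
  rw [map_sum, Finset.sum_eq_zero fun l _ => by rw [hψ, h, zero_mul], hε, if_pos rfl, map_one,
    hψ1] at h2
  exact zero_ne_one h2

end MatrixCoalgebra

section MainArgument

open Coalgebra HopfClass

theorem linearIndependent_pow_of_ncard_grouplikes {k H : Type*} [Field k] [Ring H]
    [HopfAlgebra k H] {p : ℕ} {c : H} (hc : IsGroupLikeElem k c)
    (hG : (grouplikes k H).ncard = p) (hgen : ∀ g ∈ grouplikes k H, ∃ i : ℕ, g = c ^ i) :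
    c ^ p = 1 ∧ LinearIndependent k fun i : Fin p => c ^ (i : ℕ) := by
  obtain ⟨u, rfl⟩ := hc.isUnit
  have h1 : grouplikes k H = Units.val '' (Submonoid.powers u : Set Hˣ) := by
    ext g
    refine ⟨fun hg => ?_, ?_⟩
    · obtain ⟨i, rfl⟩ := hgen g hg
      exact ⟨u ^ i, ⟨i, rfl⟩, Units.val_pow_eq_pow_val u i⟩
    · rintro ⟨_, ⟨i, rfl⟩, rfl⟩
      exact isGrouplikeWrt_comulL_iff.mpr (by simpa using hc.pow (n := i))
  have h2 : orderOf (u : H) = p := by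
    rw [← hG, h1, Set.ncard_image_of_injective _ Units.val_injective, orderOf_units,
      ← Nat.card_coe_set_eq]
    exact Nat.card_submonoidPowers.symm
  refine ⟨h2 ▸ pow_orderOf_eq_one (u : H), ?_⟩
  have h3 := linearIndepOn_isGroupLikeElem (R := k) (A := H)
  refine h3.comp (fun i : Fin p => ⟨(u : H) ^ (i : ℕ), hc.pow⟩) fun i j hij => Fin.ext ?_
  exact pow_injOn_Iio_orderOf (h2 ▸ i.2) (h2 ▸ j.2) (congrArg Subtype.val hij)

theorem exists_mulLeft_fixed_of_map_eq {k H B : Type*} [Field k] [CharZero k] [Ring H]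
    [Bialgebra k H] [Ring B] [Bialgebra k B] {p : ℕ} (hp : p ≠ 0) {c : H} (hcp : c ^ p = 1)
    (π : H →ₐc[k] B) (hπc : π c = 1) (h : H) : ∃ y, c * y = y ∧ π y = π h := by
  refine ⟨(p : k)⁻¹ • ∑ i ∈ Finset.range p, c ^ i * h, ?_, ?_⟩
  · rw [mul_smul_comm, Finset.mul_sum]
    congr 1
    have h1 := Finset.sum_range_succ (fun i => c ^ i * h) p
    rw [Finset.sum_range_succ', hcp, pow_zero] at h1
    simpa [pow_succ', mul_assoc] using h1
  · simp [map_sum, hπc, smul_smul, ← Nat.cast_smul_eq_nsmul k, hp]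

theorem one_notMem_of_isSimpleSubcoalgWrt {k H : Type*} [Field k] [Ring H] [Bialgebra k H]
    {D : Submodule k H} (hD : IsSimpleSubcoalgWrt k (comulL k H) D)
    (hdim : 1 < Module.finrank k D) : (1 : H) ∉ D := by
  intro h
  have h10 : (1 : H) ≠ 0 := fun h0 => by simpa using congrArg (counit (R := k)) h0
  have hle : Submodule.span k {(1 : H)} ≤ D := by rwa [Submodule.span_singleton_le_iff_mem]
  have hlt : Submodule.span k {(1 : H)} < D := by
    refine lt_of_le_of_ne hle fun heq => ?_
    rw [← heq, finrank_span_singleton h10] at hdim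
    exact lt_irrefl _ hdim
  refine h10 (Submodule.span_singleton_eq_bot.mp (hD.2.2 _ ?_ hlt))
  intro x hx
  obtain ⟨s, rfl⟩ := Submodule.mem_span_singleton.mp hx
  rw [map_smul]
  refine Submodule.smul_mem _ _ ⟨⟨1, Submodule.mem_span_singleton_self 1⟩ ⊗ₜ
    ⟨1, Submodule.mem_span_singleton_self 1⟩, ?_⟩
  simp [Algebra.TensorProduct.one_def]

/-- If a grouplike element `c` mapping to `1` in the Taft algebra acts diagonally on a
multiplicative matrix, then its weights are `1` only on the diagonal, provided the elements fixed
by `c` are separated by the projection to the Taft algebra. -/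
theorem eq_of_weight_eq_one_of_injOn {k H B : Type*} [Field k] [IsAlgClosed k] [Ring H]
    [Bialgebra k H] [FiniteDimensional k H] [Ring B] [Bialgebra k B] (π : H →ₐc[k] B)
    {n : ℕ} {e : Fin n → Fin n → H}
    (hli : LinearIndependent k fun ij : Fin n × Fin n => e ij.1 ij.2)
    (hΔ : ∀ i j, comul (R := k) (e i j) = ∑ l, e i l ⊗ₜ[k] e l j) {c : H}
    {w : Fin n → Fin n → k} (hce : ∀ i j, c * e i j = w i j • e i j)
    (hw : ∀ i l j, w i l * w l j = w i j) (hdiag : ∀ i, w i i = 1)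
    (hinj : ∀ y z, c * y = y → c * z = z → π y = π z → y = z)
    {ν φ : B →ₗ[k] k} {r : k} (hr : r ≠ 0)
    (hν : IsNilpotent (rightHit (ν ∘ₗ (π : H →ₗ[k] B))))
    (hcomm : rightHit (φ ∘ₗ (π : H →ₗ[k] B)) ∘ₗ rightHit (ν ∘ₗ (π : H →ₗ[k] B)) =
      r • (rightHit (ν ∘ₗ (π : H →ₗ[k] B)) ∘ₗ rightHit (φ ∘ₗ (π : H →ₗ[k] B))))
    (hνc : ∀ y, c * y = y → c * rightHit (ν ∘ₗ (π : H →ₗ[k] B)) y =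
      rightHit (ν ∘ₗ (π : H →ₗ[k] B)) y)
    (hφc : ∀ y, c * y = y → c * rightHit (φ ∘ₗ (π : H →ₗ[k] B)) y =
      rightHit (φ ∘ₗ (π : H →ₗ[k] B)) y)
    (hjoint : ∀ (μ : k) (b b' : B), rightHit ν b = 0 → rightHit ν b' = 0 → rightHit φ b = μ • b →
        rightHit φ b' = μ • b' → b ≠ 0 → ∃ s : k, b' = s • b)
    {i₀ i₁ : Fin n} (hone : w i₀ i₁ = 1) : i₀ = i₁ := by
  by_contra hne
  set ν' := ν ∘ₗ (π : H →ₗ[k] B) with hν'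
  set φ' := φ ∘ₗ (π : H →ₗ[k] B) with hφ'
  let τ : Fin n → (Fin n → k) →ₗ[k] H := fun i => Fintype.linearCombination k (e i)
  have hτ : ∀ i v, τ i v = ∑ j, v j • e i j := fun i v => Fintype.linearCombination_apply k (e i) v
  have hτinj : ∀ i v u, τ i v = τ i u → v = u := fun i v u h =>
    (linearIndependent_row hli i).fintypeLinearCombination_injective h
  have hτhit : ∀ (ψ : H →ₗ[k] k) i v, rightHit ψ (τ i v) =
      τ i fun l => ∑ j, ψ (e l j) * v j := by
    intro ψ i v
    rw [hτ, hτ, rightHit_row hΔ]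
  have hτc : ∀ i v, c * τ i v = τ i fun j => w i j * v j := by
    intro i v
    rw [hτ, hτ, Finset.mul_sum]
    refine Finset.sum_congr rfl fun j _ => ?_
    rw [mul_smul_comm, hce, smul_smul, mul_comm]
  let X : Submodule k H := LinearMap.ker (LinearMap.mulLeft k c - 1)
  have hX : ∀ y, y ∈ X ↔ c * y = y := by
    intro y
    simp [X, sub_eq_zero]
  obtain ⟨f, ⟨hfX, v, rfl⟩, hf0, hNf, μ, hΓf⟩ :=
    exists_common_eigenvector hr hcomm hν (U := X ⊓ LinearMap.range (τ i₀)) (by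
      refine Submodule.ne_bot_iff _ |>.mpr ⟨e i₀ i₀, ⟨(hX _).mpr ?_, Pi.single i₀ 1, ?_⟩, hli.ne_zero (i₀, i₀)⟩
      · rw [hce, hdiag, one_smul]
      · simp [τ]) (by
      rintro _ ⟨hy, v, rfl⟩
      exact ⟨(hX _).mpr (hνc _ ((hX _).mp hy)), _, (hτhit ν' i₀ v).symm⟩) (by
      rintro _ ⟨hy, v, rfl⟩
      exact ⟨(hX _).mpr (hφc _ ((hX _).mp hy)), _, (hτhit φ' i₀ v).symm⟩)
  replace hfX := (hX _).mp hfX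
  have hv0 : v ≠ 0 := fun h => hf0 (by rw [h, map_zero])
  have hNv : (fun l => ∑ j, ν' (e l j) * v j) = 0 :=
    hτinj i₀ _ _ (by rw [← hτhit, hNf, map_zero])
  have hΓv : (fun l => ∑ j, φ' (e l j) * v j) = μ • v :=
    hτinj i₀ _ _ (by rw [← hτhit, hΓf, map_smul])
  have hwv : (fun j => w i₀ j * v j) = v := hτinj i₀ _ _ (by rw [← hτc, hfX])
  have hone' : w i₁ i₀ = 1 := by
    have h1 := hw i₁ i₀ i₁
    rwa [hone, mul_one, hdiag] at h1
  have hf₁X : c * τ i₁ v = τ i₁ v := by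
    rw [hτc]
    congr 1
    conv_rhs => rw [← hwv]
    funext j
    rw [← hw i₁ i₀ j, hone', one_mul]
  have hNf₁ : rightHit ν' (τ i₁ v) = 0 := by rw [hτhit, hNv, map_zero]
  have hΓf₁ : rightHit φ' (τ i₁ v) = μ • τ i₁ v := by rw [hτhit, hΓv, map_smul]
  obtain ⟨s, hs⟩ := hjoint μ (π (τ i₀ v)) (π (τ i₁ v))
    (by rw [← map_rightHit, ← hν', hNf, map_zero]) (by rw [← map_rightHit, ← hν', hNf₁, map_zero])
    (by rw [← map_rightHit, ← hφ', hΓf, map_smul]) (by rw [← map_rightHit, ← hφ', hΓf₁, map_smul])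
    (fun h => hf0 (hinj _ _ hfX (mul_zero c) (by rw [h, map_zero])))
  have h1 : τ i₁ v = τ i₀ (s • v) := by
    rw [map_smul]
    refine hinj _ _ hf₁X (by rw [mul_smul_comm, hfX]) (by rw [hs, map_smul])
  rw [hτ, hτ] at h1
  exact hv0 (funext fun j => eq_zero_of_smul_row_eq_row hli (Ne.symm hne) h1 j)

end MainArgument

section Transfer

variable {k H B : Type*} [Field k] [Ring H] [Bialgebra k H] [Ring B] [Bialgebra k B]

open Coalgebra

theorem comul_comp_comp {P Q : Module.End k H}
    (hP : comul ∘ₗ P = LinearMap.lTensor H P ∘ₗ comul (R := k))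
    (hQ : comul ∘ₗ Q = LinearMap.lTensor H Q ∘ₗ comul (R := k)) :
    comul ∘ₗ P ∘ₗ Q = LinearMap.lTensor H (P ∘ₗ Q) ∘ₗ comul (R := k) := by
  rw [← LinearMap.comp_assoc, hP, LinearMap.comp_assoc, hQ, LinearMap.lTensor_comp,
    LinearMap.comp_assoc]

theorem map_rightHit_pow (π : H →ₐc[k] B) (ψ : B →ₗ[k] k) (n : ℕ) (a : H) :
    π ((rightHit (ψ ∘ₗ (π : H →ₗ[k] B)) ^ n) a) = (rightHit ψ ^ n) (π a) := by
  induction n with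
  | zero => simp
  | succ n ih => rw [pow_succ', pow_succ', Module.End.mul_apply, Module.End.mul_apply,
      map_rightHit, ih]

theorem rightHit_comp_pow_eq_zero (π : H →ₐc[k] B) (ψ : B →ₗ[k] k) {n : ℕ}
    (h : rightHit ψ ^ n = 0) : rightHit (ψ ∘ₗ (π : H →ₗ[k] B)) ^ n = 0 := by
  refine eq_zero_of_colinear_of_map_eq_zero π _ ?_ fun a => ?_
  · clear h
    induction n with
    | zero => simp [Module.End.one_eq_id]
    | succ n ih =>
      rw [pow_succ]
      exact comul_comp_comp ih (comul_comp_rightHit _)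
  · rw [map_rightHit_pow, h, LinearMap.zero_apply]

theorem rightHit_comp_skewCommute (π : H →ₐc[k] B) (ν φ : B →ₗ[k] k) {r : k}
    (h : rightHit φ ∘ₗ rightHit ν = r • (rightHit ν ∘ₗ rightHit φ)) :
    rightHit (φ ∘ₗ (π : H →ₗ[k] B)) ∘ₗ rightHit (ν ∘ₗ (π : H →ₗ[k] B)) =
      r • (rightHit (ν ∘ₗ (π : H →ₗ[k] B)) ∘ₗ rightHit (φ ∘ₗ (π : H →ₗ[k] B))) := by
  rw [← sub_eq_zero]
  refine eq_zero_of_colinear_of_map_eq_zero π _ ?_ fun a => ?_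
  · rw [LinearMap.comp_sub, LinearMap.comp_smul,
      comul_comp_comp (comul_comp_rightHit _) (comul_comp_rightHit _),
      comul_comp_comp (comul_comp_rightHit _) (comul_comp_rightHit _), LinearMap.lTensor_sub,
      LinearMap.lTensor_smul, LinearMap.sub_comp, LinearMap.smul_comp]
  · have h1 := LinearMap.congr_fun h (π a)
    simp only [LinearMap.comp_apply, LinearMap.smul_apply] at h1
    simp only [LinearMap.sub_apply, LinearMap.comp_apply, LinearMap.smul_apply, map_sub, map_smul,
      map_rightHit, h1, sub_self]

end Transfer

open HopfClass in
/-- Let `H` be of type `(p,p)` with `G(H) = ⟨c⟩`, and `π : H → T_q` a surjective Hopf algebra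
map onto a Taft algebra of dimension `p²`. If `D` is a simple subcoalgebra of `H` of dimension
`p²`, then for any multiplicative matrix `(e i j)` of `D`, left multiplication by `c` moves
some simple right `D`-subcomodule (a row span) or some simple left `D`-subcomodule (a column
span). -/
theorem mulLeft_grouplike_permutes_subcomodules_nontrivially
    (k : Type*) [Field k] [IsAlgClosed k] [CharZero k]
    (H : Type*) [Ring H] [HopfAlgebra k H] [FiniteDimensional k H]
    (p : ℕ) (hp : p.Prime) (hodd : Odd p)
    (hdim : Module.finrank k H = p ^ 3)
    (hnss : ¬ IsSemisimpleRing H) (hnp : ¬ IsPointed k H) (hncop : ¬ IsCopointed k H)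
    (hG : (grouplikes k H).ncard = p)
    (hGdual : (dualGrouplikes k H).ncard = p)
    (c : H) (hc : c ∈ grouplikes k H)
    (hgen : ∀ g ∈ grouplikes k H, ∃ i : ℕ, g = c ^ i)
    (q : k) (B : Type*) [Ring B] [HopfAlgebra k B]
    (hB : IsTaftAlgebra k p q B)
    (π : H →ₐc[k] B) (hsurj : Function.Surjective π)
    (D : Submodule k H) (hD : IsSimpleSubcoalgWrt k (comulL k H) D)
    (hdimD : Module.finrank k ↥D = p ^ 2) :
    ∀ e : Fin p → Fin p → H, IsMultMatrix k H p D e →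
      (∃ i : Fin p, Submodule.map (LinearMap.mulLeft k c)
          (Submodule.span k (Set.range (e i))) ≠ Submodule.span k (Set.range (e i))) ∨
      (∃ j : Fin p, Submodule.map (LinearMap.mulLeft k c)
          (Submodule.span k (Set.range fun i => e i j)) ≠
        Submodule.span k (Set.range fun i => e i j)) := by
  intro e ⟨hli, hDspan, hΔ, hε⟩
  by_contra! hfix
  obtain ⟨hrow, hcolumn⟩ := hfix
  have hcg : IsGroupLikeElem k c := isGrouplikeWrt_comulL_iff.mp hc
  obtain ⟨hcp, hclin⟩ := linearIndependent_pow_of_ncard_grouplikes hcg hG hgen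
  have hex : ∀ i j, ∃ s : k, c * e i j = s • e i j := fun i j =>
    exists_smul_of_mem_row_of_mem_column hli
      (hrow i ▸ ⟨e i j, Submodule.subset_span ⟨j, rfl⟩, rfl⟩)
      (hcolumn j ▸ ⟨e i j, Submodule.subset_span ⟨i, rfl⟩, rfl⟩)
  choose w hce using hex
  have hw := weight_mul_weight hli hΔ hcg hce
  have he0 : ∀ i j, e i j ≠ 0 := fun i j => hli.ne_zero (i, j)
  have hdiag : ∀ i, w i i = 1 := by
    intro i
    have h1 : w i i ≠ 0 := by
      intro h
      have h2 := hce i i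
      rw [h, zero_smul] at h2
      exact he0 i i (hcg.isUnit.mul_right_eq_zero.mp h2)
    exact mul_left_cancel₀ h1 ((hw i i i).trans (mul_one _).symm)
  obtain ⟨ν, φ, hφ1, hφmul, hνmul, hnil, ⟨v, hv⟩, hcomm, hjoint⟩ :=
    exists_functionals_of_isTaftAlgebra hp hB
  have hq0 : q ≠ 0 := hB.1.ne_zero hp.ne_zero
  have hcomm' := rightHit_comp_skewCommute π ν φ hcomm
  have hnil' := rightHit_comp_pow_eq_zero π ν hnil
  obtain ⟨h₀, rfl⟩ := hsurj v
  have hv' : (rightHit (ν ∘ₗ (π : H →ₗ[k] B)) ^ (p - 1)) h₀ ≠ 0 := by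
    intro h
    rw [← map_rightHit_pow, h, map_zero] at hv
    exact hv rfl
  have hπ : ∀ (ψ : B →ₗ[k] k) a, (ψ ∘ₗ (π : H →ₗ[k] B)) a = ψ (π a) := fun _ _ => rfl
  have hφmul' : ∀ a b, (φ ∘ₗ (π : H →ₗ[k] B)) (a * b) =
      (φ ∘ₗ (π : H →ₗ[k] B)) a * (φ ∘ₗ (π : H →ₗ[k] B)) b := by
    intro a b
    simp only [hπ, map_mul, hφmul]
  have hφ1' : (φ ∘ₗ (π : H →ₗ[k] B)) 1 = 1 := by rw [hπ, map_one, hφ1]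
  have hνmul' : ∀ a b, (ν ∘ₗ (π : H →ₗ[k] B)) (a * b) =
      (ν ∘ₗ (π : H →ₗ[k] B)) a * (φ ∘ₗ (π : H →ₗ[k] B)) b +
        Coalgebra.counit a * (ν ∘ₗ (π : H →ₗ[k] B)) b := by
    intro a b
    simp only [hπ, map_mul, hνmul, CoalgHomClass.counit_comp_apply]
  have hker := mul_finrank_ker_skewDerivation_le _ _ p
    (rightHit_skewDerivation _ _ hνmul') (comul_comp_rightHit _) hnil' h₀ hv'
  have hNc := rightHit_apply_grouplike (ν ∘ₗ (π : H →ₗ[k] B)) hcg.comul_eq_tmul_self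
  have hΓc := rightHit_apply_grouplike (φ ∘ₗ (π : H →ₗ[k] B)) hcg.comul_eq_tmul_self
  have hΓmul := rightHit_mul _ _ _ hφmul'
  have hder := rightHit_skewDerivation _ _ hνmul'
  generalize hν' : ν ∘ₗ (π : H →ₗ[k] B) = ν' at *
  generalize hφ' : φ ∘ₗ (π : H →ₗ[k] B) = φ' at *
  have hνc : ν' c = 0 :=
    eq_zero_of_isNilpotent_of_apply_eq_smul ⟨p, hnil'⟩ hc.1 hNc
  rw [hνc, zero_smul] at hNc
  have hνe : ∀ i j, ν' (e i j) ≠ 0 → w i j = 1 := by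
    intro i j h
    have h1 := hνmul' c (e i j)
    rw [hνc, hcg.counit_eq_one, zero_mul, zero_add, one_mul, hce, map_smul, smul_eq_mul] at h1
    exact mul_right_cancel₀ h (h1.trans (one_mul _).symm)
  have hφe : ∀ i, ∃ l, w i l = φ' c := by
    intro i
    obtain ⟨l, hl⟩ := exists_apply_row_ne_zero hΔ hε φ' hφ1' hφmul' i
    have h1 := hφmul' c (e i l)
    rw [hce, map_smul, smul_eq_mul] at h1
    exact ⟨l, mul_right_cancel₀ hl h1⟩
  have hwone : ∀ i j, w i j = 1 → i = j := by
    intro i j hij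
    by_cases hω : φ' c = 1
    · have hfixN : ∀ y, c * y = y → c * rightHit ν' y = rightHit ν' y := by
        intro y hy
        have h1 := hder c y
        rwa [hNc, zero_mul, zero_add, hy, eq_comm] at h1
      rw [hω, one_smul] at hΓc
      have hfixΓ : ∀ y, c * y = y → c * rightHit φ' y = rightHit φ' y := by
        intro y hy
        have h1 := hΓmul c y
        rwa [hΓc, hy, eq_comm] at h1
      have hπc : π c = 1 := by
        have hΔ1 : CoalgebraStruct.comul (R := k) (1 : B) = 1 ⊗ₜ[k] 1 := by
          rw [Bialgebra.comul_one, Algebra.TensorProduct.one_def]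
        have hν1 : ν 1 = 0 := by
          have h1 := hνmul 1 1
          rw [mul_one, hφ1, Bialgebra.counit_one, mul_one, one_mul] at h1
          exact left_eq_add.mp h1
        obtain ⟨s, hs⟩ := hjoint 1 1 (π c) (by rw [rightHit_apply_grouplike ν hΔ1, hν1, zero_smul])
          (by rw [← map_rightHit, hν', hNc, map_zero])
          (by rw [rightHit_apply_grouplike φ hΔ1, hφ1])
          (by rw [← map_rightHit, hφ', hΓc, one_smul])
          (fun h => by simpa [hφ1] using congrArg φ h)
        have h1 := congrArg (Coalgebra.counit (R := k)) hs
        rw [CoalgHomClass.counit_comp_apply, hcg.counit_eq_one, map_smul, Bialgebra.counit_one,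
          smul_eq_mul, mul_one] at h1
        rw [hs, ← h1, one_smul]
      have hXdim := mul_finrank_fixed_mulLeft_le c p hcg hclin
      set X := LinearMap.ker (LinearMap.mulLeft k c - 1) with hXdef
      have hX : ∀ y, y ∈ X ↔ c * y = y := by
        intro y
        simp [X, sub_eq_zero]
      let πX : X →ₗ[k] B := (π : H →ₗ[k] B) ∘ₗ X.subtype
      have hπX : Function.Surjective πX := by
        intro b
        obtain ⟨h, rfl⟩ := hsurj b
        obtain ⟨y, hy, hyh⟩ := exists_mulLeft_fixed_of_map_eq hp.ne_zero hcp π hπc h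
        exact ⟨⟨y, (hX y).mpr hy⟩, hyh⟩
      have hXle : Module.finrank k X ≤ p ^ 2 := by
        rw [hdim, pow_succ'] at hXdim
        exact Nat.le_of_mul_le_mul_left hXdim hp.pos
      have hfinB : FiniteDimensional k B := Module.Finite.of_surjective _ hπX
      have hXeq : Module.finrank k X = Module.finrank k B := by
        refine le_antisymm (hXle.trans hB.2.1.ge) ?_
        exact LinearMap.finrank_le_finrank_of_surjective hπX
      have hπXinj : Function.Injective πX :=
        (LinearMap.injective_iff_surjective_of_finrank_eq_finrank hXeq).mpr hπX
      subst hν' hφ'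
      refine eq_of_weight_eq_one_of_injOn π hli hΔ hce hw hdiag ?_ (inv_ne_zero hq0)
        ⟨p, hnil'⟩ hcomm' hfixN hfixΓ hjoint hij
      intro y z hy hz hyz
      exact congrArg Subtype.val
        (@hπXinj ⟨y, (hX y).mpr hy⟩ ⟨z, (hX z).mpr hz⟩ hyz)
    · have : Fact p.Prime := ⟨hp⟩
      have hωp : φ' c ^ p = 1 := by
        let f : H →* k := ⟨⟨φ', hφ1'⟩, hφmul'⟩
        change f c ^ p = 1
        rw [← map_pow, hcp, map_one]
      have hprim := IsPrimitiveRoot.orderOf (φ' c)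
      rw [orderOf_eq_prime hωp hω] at hprim
      exact eq_of_weight_eq_one hw hdiag hprim hφe hij
  have hoff : ∀ l j, l ≠ j → ν' (e l j) = 0 := by
    intro l j hlj
    by_contra h
    exact hlj (hwone l j (hνe l j h))
  have hNe : ∀ i j, rightHit ν' (e i j) = 0 := by
    intro i j
    have h1 : rightHit ν' (e i j) = ν' (e j j) • e i j := by
      rw [rightHit_apply_of_comul _ ν' _ _ _ (hΔ i j)]
      refine Finset.sum_eq_single j (fun l _ hl => ?_) (by simp)
      rw [hoff l j hl, zero_smul]
    rw [h1, eq_zero_of_isNilpotent_of_apply_eq_smul ⟨p, hnil'⟩ (he0 i j) h1, zero_smul]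
  have hDker : D ≤ LinearMap.ker (rightHit ν') := by
    rw [hDspan, Submodule.span_le]
    rintro _ ⟨ij, rfl⟩
    exact hNe _ _
  have h1ker : (1 : H) ∈ LinearMap.ker (rightHit ν') := by
    have h1 := hder 1 1
    have h2 := rightHit_apply_grouplike φ' (a := 1)
      (by rw [Bialgebra.comul_one, Algebra.TensorProduct.one_def])
    rw [mul_one, h2, hφ1', one_smul, mul_one, one_mul] at h1
    exact left_eq_add.mp h1
  have hlt : D < LinearMap.ker (rightHit ν') := by
    refine lt_of_le_of_ne hDker fun h => ?_
    refine one_notMem_of_isSimpleSubcoalgWrt hD ?_ (h ▸ h1ker)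
    rw [hdimD]
    exact Nat.one_lt_pow two_ne_zero hp.one_lt
  have h1 := Submodule.finrank_lt_finrank_of_lt hlt
  rw [hdimD] at h1
  rw [hdim, pow_succ'] at hker
  exact absurd (Nat.le_of_mul_le_mul_left hker hp.pos) (not_le.mpr h1)
end

section
/- Suppose H contains a sub-Hopf algebra T isomorphic to a Taft algebra T_{q′} of dimension p², and suppose there is a surjective Hopf algebra map π: H → T_q onto a Taft algebra of dimension p². Then H contains no simple subcoalgebra of dimension p². -/
open TensorProduct

namespace HopfClass

section LinearAlgebra

universe w

variable {k V : Type*} [Field k] [AddCommGroup V] [Module k V]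

/-- The operator `X ⊗ 1 + G ⊗ Y` on `V ⊗ N`, in the shape in which a `(1, G)`-skew-primitive
element acts on a tensor product. -/
noncomputable def skewTensor {N : Type*} [AddCommGroup N] [Module k N]
    (X G : V →ₗ[k] V) (Y : N →ₗ[k] N) : V ⊗[k] N →ₗ[k] V ⊗[k] N :=
  X.rTensor N + TensorProduct.map G Y

lemma skewTensor_tmul {N : Type*} [AddCommGroup N] [Module k N]
    (X G : V →ₗ[k] V) (Y : N →ₗ[k] N) (v : V) (n : N) :
    skewTensor X G Y (v ⊗ₜ n) = X v ⊗ₜ n + G v ⊗ₜ Y n := by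
  simp [skewTensor]

lemma lTensor_skewTensor {N N' : Type*} [AddCommGroup N] [Module k N]
    [AddCommGroup N'] [Module k N'] (X G : V →ₗ[k] V) (Y : N →ₗ[k] N) (Y' : N' →ₗ[k] N')
    (f : N →ₗ[k] N') (hf : ∀ n, f (Y n) = Y' (f n)) (t : V ⊗[k] N) :
    f.lTensor V (skewTensor X G Y t) = skewTensor X G Y' (f.lTensor V t) := by
  induction t with
  | zero => simp
  | add a b ha hb => simp [ha, hb]
  | tmul v n => simp [skewTensor_tmul, hf]

lemma finrank_ker_le_add {M M' : Type*} [AddCommGroup M] [Module k M] [FiniteDimensional k M]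
    [AddCommGroup M'] [Module k M'] (K : Submodule k M) (f : M →ₗ[k] M') (L : Submodule k M')
    [FiniteDimensional k L] (hL : ∀ t ∈ K, f t ∈ L) :
    Module.finrank k K ≤ Module.finrank k L + Module.finrank k ↥(K ⊓ LinearMap.ker f) := by
  have h := LinearMap.finrank_range_add_finrank_ker (f.domRestrict K)
  have h1 : Module.finrank k (LinearMap.range (f.domRestrict K)) ≤ Module.finrank k L := by
    apply Submodule.finrank_mono
    rintro _ ⟨⟨t, ht⟩, rfl⟩
    exact hL t ht
  have h2 : Module.finrank k (LinearMap.ker (f.domRestrict K))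
      ≤ Module.finrank k ↥(K ⊓ LinearMap.ker f) := by
    rw [← Submodule.finrank_map_subtype_eq]
    apply Submodule.finrank_mono
    rintro _ ⟨⟨t, ht⟩, ht', rfl⟩
    exact ⟨ht, ht'⟩
  omega

lemma finrank_ker_skewTensor_le [FiniteDimensional k V] (X G : V →ₗ[k] V) (m : ℕ) :
    ∀ (N : Type w) [AddCommGroup N] [Module k N] [FiniteDimensional k N] (Y : N →ₗ[k] N),
      Y ^ m = 0 → Module.finrank k (LinearMap.ker (skewTensor X G Y)) ≤
        Module.finrank k (LinearMap.ker X) * Module.finrank k N := by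
  induction m with
  | zero =>
    intro N _ _ _ Y hY
    have : Subsingleton N := ⟨fun a b => by
      have ha := LinearMap.congr_fun hY a
      have hb := LinearMap.congr_fun hY b
      simp at ha hb
      rw [ha, hb]⟩
    have : Module.finrank k (LinearMap.ker (skewTensor X G Y)) = 0 :=
      Module.finrank_zero_of_subsingleton
    omega
  | succ m ih =>
    intro N _ _ _ Y hY
    have hmaps : ∀ n ∈ LinearMap.range Y, Y n ∈ LinearMap.range Y :=
      fun n _ => ⟨n, rfl⟩
    have hYm : (Y.restrict hmaps) ^ m = 0 := by
      rw [Module.End.pow_restrict]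
      ext ⟨_, ⟨n, rfl⟩⟩
      have := LinearMap.congr_fun hY n
      simpa [pow_succ] using this
    have h1 := finrank_ker_le_add (LinearMap.ker (skewTensor X G Y))
      (Y.rangeRestrict.lTensor V) (LinearMap.ker (skewTensor X G (Y.restrict hmaps))) (by
        intro t ht
        rw [LinearMap.mem_ker] at ht ⊢
        rw [← lTensor_skewTensor X G Y _ Y.rangeRestrict (fun n => rfl), ht, map_zero])
    have h2 := ih _ (Y.restrict hmaps) hYm
    have h3 : Module.finrank k ↥(LinearMap.ker (skewTensor X G Y) ⊓
        LinearMap.ker (Y.rangeRestrict.lTensor V)) ≤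
        Module.finrank k (LinearMap.ker X) * Module.finrank k (LinearMap.ker Y) := by
      rw [← Module.finrank_tensorProduct]
      refine (Submodule.finrank_mono ?_).trans (LinearMap.finrank_range_le
        (TensorProduct.map (LinearMap.ker X).subtype (LinearMap.ker Y).subtype))
      rintro t ⟨ht, hty⟩
      have hex := Module.Flat.lTensor_exact V
        (f := (LinearMap.ker Y).subtype) (g := Y.rangeRestrict) (by
          intro n
          simp [← Subtype.val_inj])
      obtain ⟨s, rfl⟩ := (hex t).1 hty
      have hs : X.rTensor _ s = 0 := by
        have hinj := Module.Flat.lTensor_preserves_injective_linearMap (M := V)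
          (LinearMap.ker Y).subtype Subtype.val_injective
        apply hinj
        have h0 : skewTensor X G (0 : LinearMap.ker Y →ₗ[k] LinearMap.ker Y) s
            = X.rTensor _ s := by simp [skewTensor]
        rw [← h0, lTensor_skewTensor X G _ Y _ (by rintro ⟨n, hn⟩; simpa using hn.symm), map_zero]
        exact ht
      have hex' := Module.Flat.rTensor_exact (LinearMap.ker Y)
        (f := (LinearMap.ker X).subtype) (g := X) (by intro n; simp)
      obtain ⟨r, rfl⟩ := (hex' s).1 hs
      refine ⟨r, ?_⟩
      rw [← LinearMap.comp_apply, LinearMap.lTensor_comp_rTensor]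
    have h4 := LinearMap.finrank_range_add_finrank_ker Y
    calc _ ≤ _ := h1
      _ ≤ _ := add_le_add h2 h3
      _ = _ := by rw [← mul_add, h4]

/-- If `X ⊗ 1 + G ⊗ X` has as large a kernel as `1 ⊗ X`, for `X` nilpotent of order exactly `p`
and `G` injective, then the kernel of `X` has dimension at most `dim V / p`. -/
lemma finrank_ker_mul_le [FiniteDimensional k V] (X G : V →ₗ[k] V) (p : ℕ) (hp : 0 < p)
    (hG : Function.Injective G)
    (hX : X ^ p = 0) (hX' : X ^ (p - 1) ≠ 0)
    (hker : Module.finrank k V * Module.finrank k (LinearMap.ker X) ≤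
      Module.finrank k (LinearMap.ker (skewTensor X G X))) :
    Module.finrank k (LinearMap.ker X) * p ≤ Module.finrank k V := by
  obtain ⟨v, hv⟩ : ∃ v, (X ^ (p - 1)) v ≠ 0 := by
    by_contra! h
    exact hX' (LinearMap.ext h)
  obtain ⟨l, hl⟩ : ∃ l : Module.Dual k V, l ((X ^ (p - 1)) v) ≠ 0 := by
    by_contra! h
    exact hv ((Module.forall_dual_apply_eq_zero_iff k _).1 h)
  let L : V →ₗ[k] (Fin p → k) := LinearMap.pi fun i => l ∘ₗ (X ^ (i : ℕ))
  have hLX : ∀ w ∈ LinearMap.ker L, X w ∈ LinearMap.ker L := by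
    intro w hw
    rw [LinearMap.mem_ker] at hw ⊢
    ext i
    have h0 : l ((X ^ ((i : ℕ) + 1)) w) = 0 := by
      rcases Nat.lt_or_ge (i + 1) p with h | h
      · exact congr_fun hw ⟨i + 1, h⟩
      · rw [pow_eq_zero_of_le h hX]; simp
    simpa [L, pow_succ] using h0
  have hli : LinearIndependent k (fun i : Fin p => L ((X ^ (p - 1 - (i : ℕ))) v)) := by
    rw [Fintype.linearIndependent_iff]
    intro c hc
    suffices h : ∀ n : ℕ, ∀ i : Fin p, p - 1 - (i : ℕ) = n → c i = 0 from fun i => h _ i rfl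
    intro n
    induction n using Nat.strong_induction_on with
    | _ n ih =>
      intro i hi
      have hci := congr_fun hc i
      rw [Finset.sum_apply, Finset.sum_eq_single i] at hci
      · have h1 : (i : ℕ) + (p - 1 - i) = p - 1 := by omega
        have h2 : c i * l ((X ^ (p - 1)) v) = 0 := by
          simpa [L, ← Module.End.mul_apply, ← pow_add, h1] using hci
        exact (mul_eq_zero.1 h2).resolve_right hl
      · intro j _ hj
        rcases lt_or_gt_of_ne (Fin.val_ne_of_ne hj) with h | h
        · have h0 : X ^ ((i : ℕ) + (p - 1 - j)) = 0 := pow_eq_zero_of_le (by omega) hX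
          simp [L, ← Module.End.mul_apply, ← pow_add, h0]
        · simp [ih (p - 1 - j) (by omega) j rfl]
      · simp
  have hLdim : p ≤ Module.finrank k (LinearMap.range L) := by
    have h := LinearIndependent.of_comp (LinearMap.range L).subtype
      (v := fun i : Fin p => L.rangeRestrict ((X ^ (p - 1 - (i : ℕ))) v)) hli
    simpa using h.fintype_card_le_finrank
  have hLd := LinearMap.finrank_range_add_finrank_ker L
  have h1 := finrank_ker_le_add (LinearMap.ker (skewTensor X G X))
      ((TensorProduct.rid k V).toLinearMap ∘ₗ l.lTensor V) ⊤ (fun _ _ => trivial)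
  rw [finrank_top] at h1
  have hXm : (X.restrict hLX) ^ p = 0 := by
    rw [Module.End.pow_restrict]
    ext w
    simp [hX]
  have h2 := finrank_ker_skewTensor_le X G p _ (X.restrict hLX) hXm
  have h3 : Module.finrank k ↥(LinearMap.ker (skewTensor X G X) ⊓
        LinearMap.ker ((TensorProduct.rid k V).toLinearMap ∘ₗ l.lTensor V)) ≤
        Module.finrank k (LinearMap.ker (skewTensor X G (X.restrict hLX))) := by
    refine (Submodule.finrank_mono ?_).trans
      (Submodule.finrank_map_le ((LinearMap.ker L).subtype.lTensor V) _)
    rintro t ⟨ht, hlt⟩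
    have hstep : ∀ (f : Module.Dual k V) (s : V ⊗[k] V),
        TensorProduct.rid k V (f.lTensor V (skewTensor X G X s)) =
          X (TensorProduct.rid k V (f.lTensor V s)) +
            G (TensorProduct.rid k V ((f ∘ₗ X).lTensor V s)) := by
      intro f s
      induction s with
      | zero => simp
      | add a b ha hb => simp only [map_add, ha, hb]; abel
      | tmul a b => simp [skewTensor_tmul]
    have hslice : ∀ i : ℕ, TensorProduct.rid k V ((l ∘ₗ (X ^ i)).lTensor V t) = 0 := by
      intro i
      induction i with
      | zero => exact hlt
      | succ i ih =>
        have h := hstep (l ∘ₗ (X ^ i)) t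
        rw [LinearMap.mem_ker.1 ht, ih] at h
        apply hG
        simpa [pow_succ, Module.End.mul_eq_comp, LinearMap.comp_assoc] using h.symm
    have hpi : ∀ (s : V ⊗[k] V) (i : Fin p),
        TensorProduct.piScalarRight k k V (Fin p) (L.lTensor V s) i =
          TensorProduct.rid k V ((l ∘ₗ (X ^ (i : ℕ))).lTensor V s) := by
      intro s i
      induction s with
      | zero => simp
      | add a b ha hb => simp only [map_add, Pi.add_apply, ha, hb]
      | tmul a b => simp [L, TensorProduct.piScalarRight_apply]
    have hLt : L.lTensor V t = 0 := by
      apply (TensorProduct.piScalarRight k k V (Fin p)).injective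
      ext i
      rw [hpi, hslice, map_zero, Pi.zero_apply]
    have hex := Module.Flat.lTensor_exact V (f := (LinearMap.ker L).subtype) (g := L)
      (by intro n; simp)
    obtain ⟨s, rfl⟩ := (hex t).1 hLt
    refine ⟨s, ?_, rfl⟩
    have hinj := Module.Flat.lTensor_preserves_injective_linearMap (M := V)
      (LinearMap.ker L).subtype Subtype.val_injective
    apply hinj
    rw [lTensor_skewTensor X G (X.restrict hLX) X (LinearMap.ker L).subtype (fun n => rfl),
      map_zero]
    exact ht
  have h4 := h2.trans (Nat.mul_le_mul_left _ (show _ ≤ Module.finrank k V - p by omega))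
  have h5 : p ≤ Module.finrank k V := by omega
  have h6 : Module.finrank k (LinearMap.ker X) * (Module.finrank k V - p) +
      Module.finrank k (LinearMap.ker X) * p =
      Module.finrank k V * Module.finrank k (LinearMap.ker X) := by
    rw [← mul_add, Nat.sub_add_cancel h5, mul_comm]
  omega

end LinearAlgebra
section Slices

variable {k M : Type*} [Field k] [AddCommGroup M] [Module k M]

/-- A tensor all of whose left and right slices lie in `C` lies in `C ⊗ C`. -/
lemma mem_range_map_subtype_of_slices [FiniteDimensional k M] (C : Submodule k M) (t : M ⊗[k] M)
    (hr : ∀ φ : Module.Dual k M, TensorProduct.rid k M (φ.lTensor M t) ∈ C)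
    (hl : ∀ φ : Module.Dual k M, TensorProduct.lid k M (φ.rTensor M t) ∈ C) :
    t ∈ LinearMap.range (TensorProduct.map C.subtype C.subtype) := by
  obtain ⟨P, hP⟩ := C.subtype.exists_leftInverse_of_injective (by simp)
  have hPC : ∀ c ∈ C, (P c : M) = c := fun c hc =>
    congr_arg Subtype.val (LinearMap.congr_fun hP ⟨c, hc⟩)
  let b := Module.finBasis k M
  have hsumr : ∀ t : M ⊗[k] M,
      t = ∑ i, TensorProduct.rid k M ((b.coord i).lTensor M t) ⊗ₜ[k] b i := by
    intro t
    induction t with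
    | zero => simp
    | add x y hx hy =>
      simp only [map_add, TensorProduct.add_tmul, Finset.sum_add_distrib]
      rw [← hx, ← hy]
    | tmul x y =>
      conv_lhs => rw [← b.sum_repr y, TensorProduct.tmul_sum]
      simp [TensorProduct.smul_tmul]
  have hsuml : ∀ t : M ⊗[k] M,
      t = ∑ i, b i ⊗ₜ[k] TensorProduct.lid k M ((b.coord i).rTensor M t) := by
    intro t
    induction t with
    | zero => simp
    | add x y hx hy =>
      simp only [map_add, TensorProduct.tmul_add, Finset.sum_add_distrib]
      rw [← hx, ← hy]
    | tmul x y =>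
      conv_lhs => rw [← b.sum_repr x, TensorProduct.sum_tmul]
      simp [TensorProduct.smul_tmul]
  have h1 : (C.subtype ∘ₗ P).rTensor M t = t := by
    conv_lhs => rw [hsumr t]
    conv_rhs => rw [hsumr t]
    simp only [map_sum, LinearMap.rTensor_tmul, LinearMap.comp_apply, Submodule.subtype_apply]
    exact Finset.sum_congr rfl fun i _ => by rw [hPC _ (hr _)]
  have h2 : (C.subtype ∘ₗ P).lTensor M t = t := by
    conv_lhs => rw [hsuml t]
    conv_rhs => rw [hsuml t]
    simp only [map_sum, LinearMap.lTensor_tmul, LinearMap.comp_apply, Submodule.subtype_apply]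
    exact Finset.sum_congr rfl fun i _ => by rw [hPC _ (hl _)]
  refine ⟨TensorProduct.map P P t, ?_⟩
  rw [← LinearMap.comp_apply, ← TensorProduct.map_comp, ← LinearMap.lTensor_comp_rTensor,
    LinearMap.comp_apply, h1, h2]

end Slices

section Actions

variable {k C : Type*} [Field k] [AddCommGroup C] [Module k C] [Coalgebra k C]

/-- The action `c ↦ c₁ φ(c₂)` of a functional on a coalgebra. -/
noncomputable def actR (φ : Module.Dual k C) : C →ₗ[k] C :=
  (TensorProduct.rid k C).toLinearMap ∘ₗ φ.lTensor C ∘ₗ comulL k C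

/-- The action `c ↦ φ(c₁) c₂` of a functional on a coalgebra. -/
noncomputable def actL (φ : Module.Dual k C) : C →ₗ[k] C :=
  (TensorProduct.lid k C).toLinearMap ∘ₗ φ.rTensor C ∘ₗ comulL k C

lemma actR_apply (φ : Module.Dual k C) (c : C) :
    actR φ c = TensorProduct.rid k C (φ.lTensor C (comulL k C c)) := rfl

lemma actL_apply (φ : Module.Dual k C) (c : C) :
    actL φ c = TensorProduct.lid k C (φ.rTensor C (comulL k C c)) := rfl

lemma actR_counit : actR (Coalgebra.counit : C →ₗ[k] k) = LinearMap.id := by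
  ext c
  simp [actR_apply]

lemma counit_comp_actR (φ : Module.Dual k C) : Coalgebra.counit ∘ₗ actR φ = φ := by
  ext c
  have h : ∀ t : C ⊗[k] C, Coalgebra.counit (R := k) (TensorProduct.rid k C (φ.lTensor C t)) =
      φ (TensorProduct.lid k C ((Coalgebra.counit (R := k)).rTensor C t)) := by
    intro t
    induction t with
    | zero => simp
    | add x y hx hy => simp only [map_add, hx, hy]
    | tmul x y => simp [mul_comm]
  simp [actR_apply, h]

lemma comul_actR (φ : Module.Dual k C) (c : C) :
    comulL k C (actR φ c) = (actR φ).lTensor C (comulL k C c) := by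
  have h1 : ∀ t : C ⊗[k] C, comulL k C (TensorProduct.rid k C (φ.lTensor C t)) =
      ((TensorProduct.rid k C).toLinearMap ∘ₗ φ.lTensor C).lTensor C
        (TensorProduct.assoc k C C C ((comulL k C).rTensor C t)) := by
    intro t
    induction t with
    | zero => simp
    | add x y hx hy => simp only [map_add, hx, hy]
    | tmul x y =>
      simp only [LinearMap.lTensor_tmul, TensorProduct.rid_tmul, map_smul, LinearMap.rTensor_tmul]
      generalize comulL k C x = s
      induction s with
      | zero => simp
      | add x y hx hy => simp only [smul_add, TensorProduct.add_tmul, map_add, hx, hy]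
      | tmul a b => simp
  rw [actR_apply, h1, Coalgebra.coassoc_apply, ← LinearMap.comp_apply, ← LinearMap.lTensor_comp]
  rfl

lemma actR_comp_actR (φ ψ : Module.Dual k C) : actR φ ∘ₗ actR ψ = actR (φ ∘ₗ actR ψ) := by
  ext c
  rw [LinearMap.comp_apply, actR_apply, comul_actR, actR_apply, LinearMap.lTensor_comp]
  rfl

lemma actL_actR (φ ψ : Module.Dual k C) (c : C) : actL φ (actR ψ c) = actR ψ (actL φ c) := by
  have h : ∀ t : C ⊗[k] C, TensorProduct.lid k C (φ.rTensor C ((actR ψ).lTensor C t)) =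
      actR ψ (TensorProduct.lid k C (φ.rTensor C t)) := by
    intro t
    induction t with
    | zero => simp
    | add x y hx hy => simp only [map_add, hx, hy]
    | tmul x y => simp
  rw [actL_apply, comul_actR, h, actL_apply]

lemma apply_actL (φ ψ : Module.Dual k C) (c : C) : ψ (actL φ c) = φ (actR ψ c) := by
  rw [actL_apply, actR_apply]
  induction comulL k C c with
  | zero => simp
  | add x y hx hy => simp only [map_add, hx, hy]
  | tmul x y => simp [mul_comm]

lemma actR_smul (r : k) (φ : Module.Dual k C) : actR (r • φ) = r • actR φ := by
  ext c; simp [actR_apply, LinearMap.lTensor_smul]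

lemma actR_zero : actR (0 : Module.Dual k C) = 0 := by
  ext c; simp [actR_apply]

lemma IsSubcoalgWrt.actR_mem {D : Submodule k C} (hD : IsSubcoalgWrt k (comulL k C) D)
    (φ : Module.Dual k C) {d : C} (hd : d ∈ D) : actR φ d ∈ D := by
  obtain ⟨s, hs⟩ := hD d hd
  rw [actR_apply, ← hs]
  clear hs
  induction s with
  | zero => simp
  | add x y hx hy => simpa only [map_add] using D.add_mem hx hy
  | tmul x y => simpa using D.smul_mem _ x.2

lemma IsSubcoalgWrt.actL_mem {D : Submodule k C} (hD : IsSubcoalgWrt k (comulL k C) D)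
    (φ : Module.Dual k C) {d : C} (hd : d ∈ D) : actL φ d ∈ D := by
  obtain ⟨s, hs⟩ := hD d hd
  rw [actL_apply, ← hs]
  clear hs
  induction s with
  | zero => simp
  | add x y hx hy => simpa only [map_add] using D.add_mem hx hy
  | tmul x y => simpa using D.smul_mem _ y.2

/-- A nonzero left coideal `Y` of a simple subcoalgebra `D` generates `D` by right translation,
and has dimension at least the square root of that of `D`. -/
lemma IsSimpleSubcoalgWrt.of_left_coideal [FiniteDimensional k C] {D : Submodule k C}
    (hD : IsSimpleSubcoalgWrt k (comulL k C) D) {Y : Submodule k C} (hYD : Y ≤ D) (hY : Y ≠ ⊥)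
    (hYL : ∀ φ : Module.Dual k C, ∀ y ∈ Y, actL φ y ∈ Y) :
    Module.finrank k D ≤ Module.finrank k Y ^ 2 ∧
      ∀ E : Submodule k C, (∀ y ∈ Y, ∀ φ : Module.Dual k C, actR φ y ∈ E) → D ≤ E := by
  let b := Module.finBasis k Y
  have hext : ∀ j, ∃ ψ : Module.Dual k C, ψ ∘ₗ Y.subtype = b.coord j :=
    fun j => LinearMap.exists_extend _
  choose ψ hψ using hext
  let W : Submodule k C := Submodule.span k (Set.range fun j : Fin _ × Fin _ =>
    actR (ψ j.1) (b j.2 : C))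
  have hcoord : ∀ φ : Module.Dual k C, ∀ y ∈ Y, φ y = ∑ j, φ (b j) * ψ j y := by
    intro φ y hy
    have h := congr_arg (fun z : Y => φ z) (b.sum_repr ⟨y, hy⟩)
    simp only [Submodule.coe_sum, Submodule.coe_smul, map_sum, map_smul, smul_eq_mul] at h
    rw [← h]
    refine Finset.sum_congr rfl fun j _ => ?_
    have := LinearMap.congr_fun (hψ j) ⟨y, hy⟩
    simp only [LinearMap.comp_apply, Submodule.subtype_apply, Module.Basis.coord_apply] at this
    rw [this, mul_comm]
  have hact : ∀ φ : Module.Dual k C, ∀ y ∈ Y, actR φ y = ∑ j, φ (b j) • actR (ψ j) y := by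
    intro φ y hy
    rw [← sub_eq_zero, ← Module.forall_dual_apply_eq_zero_iff k]
    intro χ
    rw [map_sub, sub_eq_zero, map_sum, ← apply_actL, hcoord φ _ (hYL χ y hy)]
    simp only [apply_actL, map_smul, smul_eq_mul]
  have hW : ∀ φ : Module.Dual k C, ∀ y ∈ Y, actR φ y ∈ W := by
    intro φ y hy
    rw [hact φ y hy]
    refine Submodule.sum_mem _ fun j _ => Submodule.smul_mem _ _ ?_
    have h : y = ∑ l, b.repr ⟨y, hy⟩ l • (b l : C) := by
      have h := congr_arg Subtype.val (b.sum_repr ⟨y, hy⟩)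
      rw [Submodule.coe_sum] at h
      exact h.symm
    rw [h, map_sum]
    refine Submodule.sum_mem _ fun l _ => ?_
    rw [map_smul]
    exact Submodule.smul_mem _ _ (Submodule.subset_span ⟨(j, l), rfl⟩)
  have hle : ∀ E : Submodule k C, (∀ y ∈ Y, ∀ φ : Module.Dual k C, actR φ y ∈ E) → W ≤ E := by
    intro E hE
    refine Submodule.span_le.2 ?_
    rintro _ ⟨j, rfl⟩
    exact hE _ (b j.2).2 _
  have hYW : Y ≤ W := fun y hy => by
    simpa [actR_counit] using hW Coalgebra.counit y hy
  have hsub : IsSubcoalgWrt k (comulL k C) W := by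
    have hspan : W ≤ (LinearMap.range (TensorProduct.map W.subtype W.subtype)).comap
        (comulL k C) := by
      refine hle _ fun y hy φ => ?_
      refine mem_range_map_subtype_of_slices W _ (fun χ => ?_) (fun χ => ?_)
      · rw [← actR_apply, ← LinearMap.comp_apply, actR_comp_actR]
        exact hW _ y hy
      · rw [← actL_apply, actL_actR]
        exact hW _ _ (hYL _ y hy)
    exact fun x hx => hspan hx
  have hWD : W ≤ D := hle D fun y hy φ => hD.1.actR_mem φ (hYD hy)
  have hWeq : W = D := by
    by_contra hne
    have := hD.2.2 W hsub (lt_of_le_of_ne hWD hne)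
    exact hY (le_bot_iff.1 (this ▸ hYW))
  refine ⟨?_, fun E hE => hWeq ▸ hle E hE⟩
  rw [← hWeq]
  refine (finrank_range_le_card _).trans ?_
  simp [sq]

lemma IsSimpleSubcoalgWrt.notMem_of_grouplike {D : Submodule k C}
    (hD : IsSimpleSubcoalgWrt k (comulL k C) D) (hdim : Module.finrank k D ≠ 1)
    {y : C} (hy : IsGrouplikeWrt k (comulL k C) y) : y ∉ D := by
  intro hyD
  have hle : Submodule.span k {y} ≤ D := by simpa using hyD
  have hsub : IsSubcoalgWrt k (comulL k C) (Submodule.span k {y}) := by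
    intro x hx
    obtain ⟨r, rfl⟩ := Submodule.mem_span_singleton.1 hx
    refine ⟨r • (⟨y, Submodule.mem_span_singleton_self y⟩ ⊗ₜ
      ⟨y, Submodule.mem_span_singleton_self y⟩), ?_⟩
    rw [map_smul, map_smul, hy.2]
    rfl
  have hne : Submodule.span k {y} ≠ D := by
    rintro rfl
    exact hdim (finrank_span_singleton hy.1)
  have := hD.2.2 _ hsub (lt_of_le_of_ne hle hne)
  exact hy.1 (Submodule.span_singleton_eq_bot.1 this)

end Actions

section Bialgebra

variable {k H : Type*} [Field k] [Ring H] [Bialgebra k H]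

lemma actR_mul_of_apply_mul {φ φ₁ φ₂ φ₃ φ₄ : Module.Dual k H}
    (h : ∀ u v, φ (u * v) = φ₁ u * φ₂ v + φ₃ u * φ₄ v) (u v : H) :
    actR φ (u * v) = actR φ₁ u * actR φ₂ v + actR φ₃ u * actR φ₄ v := by
  have key : ∀ s t : H ⊗[k] H, TensorProduct.rid k H (φ.lTensor H (s * t)) =
      TensorProduct.rid k H (φ₁.lTensor H s) * TensorProduct.rid k H (φ₂.lTensor H t) +
      TensorProduct.rid k H (φ₃.lTensor H s) * TensorProduct.rid k H (φ₄.lTensor H t) := by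
    intro s t
    induction s with
    | zero => simp
    | add x y hx hy => simp only [add_mul, map_add, hx, hy]; abel
    | tmul a b =>
      induction t with
      | zero => simp
      | add x y hx hy => simp only [mul_add, map_add, hx, hy]; abel
      | tmul c d => simp [h, add_smul, smul_smul, mul_comm]
  simp only [actR_apply]
  rw [← key]
  congr 2
  exact Bialgebra.comul_mul u v

lemma actR_one (φ : Module.Dual k H) : actR φ (1 : H) = φ 1 • 1 := by
  rw [actR_apply]
  simp [Algebra.TensorProduct.one_def]

lemma actR_grouplike (φ : Module.Dual k H) {g : H} (hg : IsGrouplikeWrt k (comulL k H) g) :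
    actR φ g = φ g • g := by
  rw [actR_apply, hg.2]
  simp

lemma actR_skewPrimitive (φ : Module.Dual k H) {g x : H}
    (hx : CoalgebraStruct.comul (R := k) x = x ⊗ₜ[k] (1 : H) + g ⊗ₜ[k] x) :
    actR φ x = φ 1 • x + φ x • g := by
  rw [actR_apply, comulL, hx]
  simp

lemma counit_grouplike {g : H} (hg : IsGrouplikeWrt k (comulL k H) g) :
    Coalgebra.counit (R := k) g = 1 := by
  have h := actR_grouplike (Coalgebra.counit : H →ₗ[k] k) hg
  rw [actR_counit, LinearMap.id_apply] at h
  have h2 : (Coalgebra.counit (R := k) g - 1) • g = 0 := by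
    rw [sub_smul, ← h, one_smul, sub_self]
  rcases smul_eq_zero.1 h2 with h3 | h3
  · exact sub_eq_zero.1 h3
  · exact absurd h3 hg.1

lemma isGrouplikeWrt_one [Nontrivial H] : IsGrouplikeWrt k (comulL k H) (1 : H) :=
  ⟨one_ne_zero, by simp [Algebra.TensorProduct.one_def]⟩

lemma isGrouplikeWrt_pow {g : H} (hg : IsGrouplikeWrt k (comulL k H) g) (n : ℕ) :
    IsGrouplikeWrt k (comulL k H) (g ^ n) := by
  have : Nontrivial H := ⟨g, 0, hg.1⟩
  induction n with
  | zero => simpa using isGrouplikeWrt_one (k := k) (H := H)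
  | succ n ih =>
    refine ⟨?_, ?_⟩
    · intro h0
      have h := counit_grouplike ih
      have h' := counit_grouplike hg
      have : Coalgebra.counit (R := k) (g ^ (n + 1)) = 1 := by
        rw [pow_succ, Bialgebra.counit_mul, h, h', one_mul]
      rw [h0, map_zero] at this
      exact zero_ne_one this
    · have h1 := ih.2
      have h2 := hg.2
      simp only [comulL] at h1 h2 ⊢
      rw [pow_succ, Bialgebra.comul_mul, h1, h2, Algebra.TensorProduct.tmul_mul_tmul]

lemma counit_skewPrimitive {g x : H} (hg : IsGrouplikeWrt k (comulL k H) g)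
    (hx : CoalgebraStruct.comul (R := k) x = x ⊗ₜ[k] (1 : H) + g ⊗ₜ[k] x) :
    Coalgebra.counit (R := k) x = 0 := by
  have h := actR_skewPrimitive (Coalgebra.counit : H →ₗ[k] k) hx
  rw [actR_counit, LinearMap.id_apply, Bialgebra.counit_one, one_smul, left_eq_add] at h
  exact (smul_eq_zero.1 h).resolve_right hg.1

end Bialgebra

section Taft

variable {k B : Type*} [Field k] [Ring B] [Algebra k B]

lemma skew_pow_mul_pow {q : k} (hq : q ≠ 0) {g x : B} (hgx : g * x = q • (x * g)) (j l : ℕ) :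
    x ^ j * g ^ l = (q⁻¹) ^ (j * l) • (g ^ l * x ^ j) := by
  have h1 : x * g = q⁻¹ • (g * x) := by rw [hgx, smul_smul, inv_mul_cancel₀ hq, one_smul]
  have h2 : ∀ l : ℕ, x * g ^ l = (q⁻¹) ^ l • (g ^ l * x) := by
    intro l
    induction l with
    | zero => simp
    | succ l ih =>
      rw [pow_succ, ← mul_assoc, ih, smul_mul_assoc, mul_assoc, h1, mul_smul_comm, smul_smul,
        ← pow_succ, mul_assoc]
  induction j with
  | zero => simp
  | succ j ih =>
    rw [pow_succ, mul_assoc, h2, mul_smul_comm, ← mul_assoc, ih, smul_mul_assoc, smul_smul,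
      ← pow_add, mul_assoc]
    congr 2
    ring

lemma span_skew_monomials {q : k} (hq : q ≠ 0) {g x : B} (hgx : g * x = q • (x * g))
    (hgen : Algebra.adjoin k {g, x} = (⊤ : Subalgebra k B)) :
    Submodule.span k (Set.range fun n : ℕ × ℕ => g ^ n.1 * x ^ n.2) = ⊤ := by
  rw [eq_top_iff, ← Algebra.top_toSubmodule, ← hgen, Algebra.adjoin_eq_span, Submodule.span_le]
  intro m hm
  induction hm using Submonoid.closure_induction_right with
  | one => exact Submodule.subset_span ⟨(0, 0), by simp⟩
  | mul_right m hm y hy ih =>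
    rw [SetLike.mem_coe] at ih ⊢
    clear hm
    induction ih using Submodule.span_induction with
    | zero => simp
    | add a b _ _ ha hb => rw [add_mul]; exact Submodule.add_mem _ ha hb
    | smul r a _ ha => rw [smul_mul_assoc]; exact Submodule.smul_mem _ _ ha
    | mem a ha =>
      obtain ⟨⟨i, j⟩, rfl⟩ := ha
      rcases hy with rfl | rfl
      · have h := skew_pow_mul_pow hq hgx j 1
        rw [pow_one] at h
        dsimp only
        rw [mul_assoc, h, mul_smul_comm, ← mul_assoc, ← pow_succ]
        exact Submodule.smul_mem _ _ (Submodule.subset_span ⟨(i + 1, j), rfl⟩)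
      · dsimp only
        rw [mul_assoc, ← pow_succ]
        exact Submodule.subset_span ⟨(i, j + 1), rfl⟩

lemma ext_skew_monomials {q : k} (hq : q ≠ 0) {g x : B} (hgx : g * x = q • (x * g))
    (hgen : Algebra.adjoin k {g, x} = (⊤ : Subalgebra k B)) {M : Type*} [AddCommGroup M]
    [Module k M] {f f' : B →ₗ[k] M} (h : ∀ i j : ℕ, f (g ^ i * x ^ j) = f' (g ^ i * x ^ j)) :
    f = f' :=
  LinearMap.ext_on_range (span_skew_monomials hq hgx hgen) fun n => h n.1 n.2

/-- In an algebra of dimension `p²` generated by `g` and `x` subject to the Taft relations, a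
linear functional may be prescribed on the monomials `g ^ i * x ^ j`. -/
lemma exists_dual_of_taft_relations {q : k} {p : ℕ} (hp : 0 < p) (hq : q ≠ 0) {g x : B}
    (hdim : Module.finrank k B = p ^ 2) (hg : g ^ p = 1) (hx : x ^ p = 0)
    (hgx : g * x = q • (x * g)) (hgen : Algebra.adjoin k {g, x} = (⊤ : Subalgebra k B))
    (c : ℕ → ℕ → k) (hc : ∀ i j, c (i % p) j = c i j) (hc' : ∀ i j, p ≤ j → c i j = 0) :
    ∃ f : Module.Dual k B, ∀ i j, f (g ^ i * x ^ j) = c i j := by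
  have hgmod : ∀ i, g ^ i = g ^ (i % p) := fun i => by
    conv_lhs => rw [← Nat.div_add_mod i p, pow_add, pow_mul, hg, one_pow, one_mul]
  have hspan : ⊤ ≤ Submodule.span k (Set.range fun n : Fin p × Fin p =>
      g ^ (n.1 : ℕ) * x ^ (n.2 : ℕ)) := by
    rw [← span_skew_monomials hq hgx hgen, Submodule.span_le]
    rintro _ ⟨⟨i, j⟩, rfl⟩
    rcases Nat.lt_or_ge j p with h | h
    · exact Submodule.subset_span
        ⟨(⟨i % p, Nat.mod_lt _ hp⟩, ⟨j, h⟩), by simp only [← hgmod]⟩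
    · simp [pow_eq_zero_of_le h hx]
  let b := basisOfTopLeSpanOfCardEqFinrank _ hspan (by simp [hdim, sq])
  refine ⟨b.constr k fun n => c n.1 n.2, fun i j => ?_⟩
  rcases Nat.lt_or_ge j p with h | h
  · have h1 : g ^ i * x ^ j = b (⟨i % p, Nat.mod_lt _ hp⟩, ⟨j, h⟩) := by
      simp [b, ← hgmod]
    rw [h1, Module.Basis.constr_basis]
    exact hc i j
  · rw [pow_eq_zero_of_le h hx, mul_zero, map_zero, hc' i j h]

end Taft

section TaftFunctionals

variable {k B : Type*} [Field k] [Ring B] [Bialgebra k B]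

/-- The dual of a Taft algebra contains a grouplike element `a` and a skew-primitive element `b`
satisfying the Taft relations, here expressed through the operators they induce. -/
lemma IsTaftAlgebra.exists_functionals {p : ℕ} (hp : 1 < p) {q : k} (hB : IsTaftAlgebra k p q B) :
    ∃ a b : Module.Dual k B, a 1 = 1 ∧ (∀ u v, a (u * v) = a u * a v) ∧
      (∀ u v, b (u * v) = b u * Coalgebra.counit v + a u * b v) ∧
      actR a ∘ₗ actR b = q • actR b ∘ₗ actR a ∧
      actR a ^ p = 1 ∧ actR b ^ p = 0 ∧ actR b ^ (p - 1) ≠ 0 := by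
  obtain ⟨hq, hdim, g, x, hg, hx, hgp, hxp, hgx, hgen⟩ := hB
  have hp0 : 0 < p := by omega
  have hq0 : q ≠ 0 := hq.ne_zero (by omega)
  have hqmod : ∀ i, q ^ (i % p) = q ^ i := fun i => by
    conv_rhs => rw [← Nat.div_add_mod i p, pow_add, pow_mul, hq.pow_eq_one, one_pow, one_mul]
  have hmul : ∀ i j l m : ℕ, (g ^ i * x ^ j) * (g ^ l * x ^ m) =
      (q⁻¹) ^ (j * l) • (g ^ (i + l) * x ^ (j + m)) := by
    intro i j l m
    rw [mul_assoc, ← mul_assoc (x ^ j), skew_pow_mul_pow hq0 hgx, smul_mul_assoc,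
      mul_smul_comm, pow_add, pow_add]
    simp only [mul_assoc]
  obtain ⟨a, ha⟩ := exists_dual_of_taft_relations hp0 hq0 hdim hgp hxp hgx hgen
    (fun i j => if j = 0 then q ^ i else 0) (fun i j => by simp [hqmod])
    (fun i j hj => if_neg (by omega))
  obtain ⟨b, hb⟩ := exists_dual_of_taft_relations hp0 hq0 hdim hgp hxp hgx hgen
    (fun i j => if j = 1 then q ^ i else 0) (fun i j => by simp [hqmod])
    (fun i j hj => if_neg (by omega))
  have hε : ∀ i j : ℕ, Coalgebra.counit (R := k) (g ^ i * x ^ j) = if j = 0 then 1 else 0 := by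
    intro i j
    rw [Bialgebra.counit_mul, Bialgebra.counit_pow, Bialgebra.counit_pow, counit_grouplike hg,
      counit_skewPrimitive hg hx, one_pow, one_mul, zero_pow_eq]
  have hext₂ : ∀ f f' : B →ₗ[k] B →ₗ[k] k,
      (∀ i j l m : ℕ, f (g ^ i * x ^ j) (g ^ l * x ^ m) = f' (g ^ i * x ^ j) (g ^ l * x ^ m)) →
      f = f' := fun f f' h =>
    ext_skew_monomials hq0 hgx hgen fun i j => ext_skew_monomials hq0 hgx hgen (h i j)
  have hamul : ∀ u v, a (u * v) = a u * a v := by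
    have h := hext₂ ((LinearMap.mul k B).compr₂ a) ((LinearMap.mul k k).compl₁₂ a a) (by
      intro i j l m
      simp only [LinearMap.compr₂_apply, LinearMap.mul_apply', LinearMap.compl₁₂_apply, hmul,
        map_smul, ha]
      rcases j with _ | j <;> rcases m with _ | m <;> simp [pow_add])
    exact fun u v => LinearMap.congr_fun₂ h u v
  have hbmul : ∀ u v, b (u * v) = b u * Coalgebra.counit v + a u * b v := by
    have h := hext₂ ((LinearMap.mul k B).compr₂ b)
      ((LinearMap.mul k k).compl₁₂ b Coalgebra.counit + (LinearMap.mul k k).compl₁₂ a b) (by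
      intro i j l m
      simp only [LinearMap.compr₂_apply, LinearMap.mul_apply', LinearMap.compl₁₂_apply, hmul,
        map_smul, ha, hb, hε, LinearMap.add_apply]
      rcases j with _ | j <;> rcases m with _ | m
      · simp
      · simp [pow_add]
      · rcases j with _ | j
        · simp [pow_add]; field_simp
        · simp
      · have h0 : j + 1 + (m + 1) ≠ 1 := by omega
        simp [h0])
    exact fun u v => LinearMap.congr_fun₂ h u v
  have ha1 : a 1 = 1 := by simpa using ha 0 0
  have hb1 : b 1 = 0 := by simpa using hb 0 0
  have hAmul : ∀ u v, actR a (u * v) = actR a u * actR a v := fun u v => by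
    simpa [actR_zero] using actR_mul_of_apply_mul (φ₃ := 0) (φ₄ := 0)
      (fun u v => by simpa using hamul u v) u v
  have hXmul : ∀ u v, actR b (u * v) = actR b u * v + actR a u * actR b v := fun u v => by
    simpa [actR_counit] using actR_mul_of_apply_mul hbmul u v
  have hAg : ∀ i : ℕ, actR a (g ^ i) = q ^ i • g ^ i := fun i => by
    rw [actR_grouplike a (isGrouplikeWrt_pow hg i)]
    congr 1
    simpa using ha i 0
  have hAx : ∀ j : ℕ, actR a (x ^ j) = x ^ j := by
    intro j
    induction j with
    | zero => simp [actR_one, ha1]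
    | succ j ih =>
      have h : a x = 0 := by simpa using ha 0 1
      rw [pow_succ, hAmul, ih, actR_skewPrimitive a hx, ha1, h, one_smul, zero_smul, add_zero]
  have hXg : ∀ i : ℕ, actR b (g ^ i) = 0 := fun i => by
    have h : b (g ^ i) = 0 := by simpa using hb i 0
    rw [actR_grouplike b (isGrouplikeWrt_pow hg i), h, zero_smul]
  have hXx1 : actR b x = g := by
    have h : b x = 1 := by simpa using hb 0 1
    rw [actR_skewPrimitive b hx, hb1, h, zero_smul, one_smul, zero_add]
  let c : ℕ → k := fun n => ∑ i ∈ Finset.range n, (q⁻¹) ^ i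
  have hXx : ∀ j : ℕ, actR b (x ^ (j + 1)) = c (j + 1) • (g * x ^ j) := by
    intro j
    induction j with
    | zero => simp [hXx1, c]
    | succ j ih =>
      have h1 := skew_pow_mul_pow hq0 hgx 1 1
      simp only [pow_one, mul_one] at h1
      have h2 := hAx 1
      rw [pow_one] at h2
      have h3 : c (j + 1 + 1) = q⁻¹ * c (j + 1) + 1 := geom_sum_succ
      rw [pow_succ' x (j + 1), hXmul, hXx1, h2, ih, mul_smul_comm, ← mul_assoc, h1,
        smul_mul_assoc, mul_assoc, ← pow_succ', smul_smul, h3, add_smul, one_smul, add_comm,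
        mul_comm (c (j + 1))]
  have hA : ∀ i j : ℕ, actR a (g ^ i * x ^ j) = q ^ i • (g ^ i * x ^ j) := fun i j => by
    rw [hAmul, hAg, hAx, smul_mul_assoc]
  have hX0 : ∀ i : ℕ, actR b (g ^ i * x ^ 0) = 0 := fun i => by
    rw [pow_zero, mul_one, hXg]
  have hX : ∀ i j : ℕ, actR b (g ^ i * x ^ (j + 1)) =
      (q ^ i * c (j + 1)) • (g ^ (i + 1) * x ^ j) := fun i j => by
    rw [hXmul, hXg, zero_mul, zero_add, hAg, hXx, smul_mul_assoc, mul_smul_comm, smul_smul,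
      ← mul_assoc, ← pow_succ]
  have hc : ∀ n, 0 < n → n < p → c n ≠ 0 := by
    intro n hn hnp h0
    have h1 := mul_neg_geom_sum (q⁻¹) n
    rw [show ∑ i ∈ Finset.range n, (q⁻¹) ^ i = 0 from h0, mul_zero] at h1
    exact hq.inv.pow_ne_one_of_pos_of_lt (by omega) hnp (sub_eq_zero.1 h1.symm).symm
  refine ⟨a, b, ha1, hamul, hbmul, ?_, ?_, ?_, ?_⟩
  · refine ext_skew_monomials hq0 hgx hgen fun i j => ?_
    rcases j with _ | j
    · simp only [LinearMap.comp_apply, LinearMap.smul_apply, hA, hX0, map_smul, map_zero,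
        smul_zero]
    · simp only [LinearMap.comp_apply, LinearMap.smul_apply, hA, hX, map_smul, smul_smul]
      congr 1
      ring
  · have h : ∀ n i j : ℕ, (actR a ^ n) (g ^ i * x ^ j) = (q ^ i) ^ n • (g ^ i * x ^ j) := by
      intro n i j
      induction n with
      | zero => simp
      | succ n ih => rw [pow_succ', Module.End.mul_apply, ih, map_smul, hA, smul_smul, pow_succ]
    refine ext_skew_monomials hq0 hgx hgen fun i j => ?_
    rw [h, ← pow_mul, mul_comm, pow_mul, hq.pow_eq_one, one_pow, one_smul]
    rfl
  · have h : ∀ n i j : ℕ, j < n → (actR b ^ n) (g ^ i * x ^ j) = 0 := by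
      intro n
      induction n with
      | zero => intro i j hj; omega
      | succ n ih =>
        intro i j hj
        rw [pow_succ, Module.End.mul_apply]
        rcases j with _ | j
        · rw [hX0, map_zero]
        · rw [hX, map_smul, ih _ _ (by omega), smul_zero]
    refine ext_skew_monomials hq0 hgx hgen fun i j => ?_
    rcases Nat.lt_or_ge j p with hj | hj
    · rw [h p i j hj]; rfl
    · rw [pow_eq_zero_of_le hj hxp, mul_zero, map_zero, map_zero]
  · have h : ∀ n : ℕ, n < p → ∀ i : ℕ, ∃ r : k, r ≠ 0 ∧
        (actR b ^ n) (g ^ i * x ^ n) = r • g ^ (i + n) := by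
      intro n
      induction n with
      | zero => intro _ i; exact ⟨1, one_ne_zero, by simp⟩
      | succ n ih =>
        intro hn i
        obtain ⟨r, hr, hr'⟩ := ih (by omega) (i + 1)
        refine ⟨q ^ i * c (n + 1) * r,
          mul_ne_zero (mul_ne_zero (pow_ne_zero _ hq0) (hc _ (by omega) hn)) hr, ?_⟩
        rw [pow_succ, Module.End.mul_apply, hX, map_smul, hr', smul_smul, add_assoc, add_comm 1]
    intro h0
    obtain ⟨r, hr, hr'⟩ := h (p - 1) (by omega) 0
    rw [h0, LinearMap.zero_apply] at hr'
    exact smul_ne_zero hr (isGrouplikeWrt_pow hg _).1 hr'.symm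

end TaftFunctionals

section LinearAlgebra

variable {k V : Type*} [Field k] [AddCommGroup V] [Module k V] [FiniteDimensional k V]

lemma sum_finrank_inf_eigenspace_le (f : Module.End k V) (K : Submodule k V) (s : Finset k) :
    ∑ μ ∈ s, Module.finrank k ↥(K ⊓ f.eigenspace μ) ≤ Module.finrank k K := by
  classical
  have hind : iSupIndep fun μ : s => K ⊓ f.eigenspace (μ : k) :=
    (f.eigenspaces_iSupIndep.comp Subtype.val_injective).mono fun μ => inf_le_right
  let e := DirectSum.coeLinearMap fun μ : s => K ⊓ f.eigenspace (μ : k)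
  have hinj : Function.Injective e := hind.dfinsupp_lsum_injective
  have hK : ∀ t, e t ∈ K := by
    intro t
    induction t using DirectSum.induction_on with
    | zero => simp
    | add x y hx hy => rw [map_add]; exact K.add_mem hx hy
    | of i x => rw [← DirectSum.lof_eq_of k, DirectSum.coeLinearMap_lof]; exact x.2.1
  have h := LinearMap.finrank_le_finrank_of_injective (f := e.codRestrict K hK)
    fun x y hxy => hinj (congr_arg Subtype.val hxy)
  rw [Module.finrank_directSum] at h
  rwa [← Finset.sum_coe_sort]

lemma finrank_mul_finrank_ker_le_finrank_ker {W : Type*} [AddCommGroup W] [Module k W]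
    [FiniteDimensional k W] (X : W →ₗ[k] W) {θ S : V ⊗[k] W →ₗ[k] V ⊗[k] W}
    (hθ : Function.Injective θ) (h : θ ∘ₗ S = X.lTensor V ∘ₗ θ) :
    Module.finrank k V * Module.finrank k (LinearMap.ker X) ≤
      Module.finrank k (LinearMap.ker S) := by
  have h1 : Module.finrank k (LinearMap.range S) ≤
      Module.finrank k V * Module.finrank k (LinearMap.range X) := by
    have h2 : LinearMap.range (θ ∘ₗ S) ≤
        LinearMap.range ((LinearMap.range X).subtype.lTensor V) := by
      rw [h]
      have h3 : X.lTensor V =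
          (LinearMap.range X).subtype.lTensor V ∘ₗ X.rangeRestrict.lTensor V := by
        rw [← LinearMap.lTensor_comp]; rfl
      rw [h3, LinearMap.comp_assoc]
      exact LinearMap.range_comp_le_range _ _
    have h4 : Module.finrank k (LinearMap.range (θ ∘ₗ S)) =
        Module.finrank k (LinearMap.range S) := by
      rw [LinearMap.range_comp]
      exact LinearEquiv.finrank_eq (Submodule.equivMapOfInjective θ hθ _).symm
    rw [← h4]
    refine (Submodule.finrank_mono h2).trans ((LinearMap.finrank_range_le _).trans ?_)
    rw [Module.finrank_tensorProduct]
  have h5 := LinearMap.finrank_range_add_finrank_ker S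
  have h6 := LinearMap.finrank_range_add_finrank_ker X
  rw [Module.finrank_tensorProduct, ← h6, mul_add] at h5
  omega

end LinearAlgebra

section Pullback

variable {k C C' : Type*} [Field k] [AddCommGroup C] [Module k C] [Coalgebra k C]
  [AddCommGroup C'] [Module k C'] [Coalgebra k C']

lemma map_actR (π : C →ₗc[k] C') (f : Module.Dual k C') (c : C) :
    π (actR (f ∘ₗ π.toLinearMap) c) = actR f (π c) := by
  have h : ∀ t : C ⊗[k] C, π (TensorProduct.rid k C ((f ∘ₗ π.toLinearMap).lTensor C t)) =
      TensorProduct.rid k C' (f.lTensor C'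
        (TensorProduct.map π.toLinearMap π.toLinearMap t)) := by
    intro t
    induction t with
    | zero => simp
    | add x y hx hy => simp only [map_add, hx, hy]
    | tmul x y => simp
  rw [actR_apply, h, actR_apply]
  congr 2
  exact CoalgHomClass.map_comp_comul_apply π c

lemma actR_congr (π : C →ₗc[k] C') {φ ψ : Module.Dual k C}
    (h : ∀ c, π (actR φ c) = π (actR ψ c)) : actR φ = actR ψ := by
  have hε : ∀ c, Coalgebra.counit (R := k) (π c) = Coalgebra.counit (R := k) c :=
    fun c => CoalgHomClass.counit_comp_apply π c
  congr 1
  rw [← counit_comp_actR φ, ← counit_comp_actR ψ]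
  ext c
  rw [LinearMap.comp_apply, LinearMap.comp_apply, ← hε, h, hε]

lemma exists_actR_pow (φ : Module.Dual k C) (n : ℕ) :
    ∃ ψ : Module.Dual k C, actR φ ^ n = actR ψ := by
  induction n with
  | zero => exact ⟨Coalgebra.counit, by rw [actR_counit]; rfl⟩
  | succ n ih =>
    obtain ⟨ψ, hψ⟩ := ih
    exact ⟨ψ ∘ₗ actR φ, by rw [pow_succ, hψ, ← actR_comp_actR]; rfl⟩

lemma map_actR_pow (π : C →ₗc[k] C') (f : Module.Dual k C') (n : ℕ) (c : C) :
    π ((actR (f ∘ₗ π.toLinearMap) ^ n) c) = (actR f ^ n) (π c) := by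
  induction n generalizing c with
  | zero => rfl
  | succ n ih => rw [pow_succ, pow_succ, Module.End.mul_apply, Module.End.mul_apply, ih, map_actR]

end Pullback

section TaftQuotient

variable {k H B : Type*} [Field k] [Ring H] [Bialgebra k H] [Ring B] [Bialgebra k B]

/-- A bialgebra mapping onto a Taft algebra inherits the grouplike and skew-primitive functionals
of the latter. -/
lemma IsTaftAlgebra.exists_functionals_of_surjective {p : ℕ} (hp : 1 < p) {q : k}
    (hB : IsTaftAlgebra k p q B) (π : H →ₐc[k] B) (hπ : Function.Surjective π) :
    ∃ a b : Module.Dual k H, a 1 = 1 ∧ (∀ u v, a (u * v) = a u * a v) ∧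
      (∀ u v, b (u * v) = b u * Coalgebra.counit v + a u * b v) ∧
      actR a ∘ₗ actR b = q • actR b ∘ₗ actR a ∧
      actR a ^ p = 1 ∧ actR b ^ p = 0 ∧ actR b ^ (p - 1) ≠ 0 := by
  obtain ⟨a, b, ha1, ha, hb, hab, hap, hbp, hbp'⟩ := hB.exists_functionals hp
  let π' : H →ₗc[k] B := π
  have hπ' : ∀ h, π' h = π h := fun _ => rfl
  refine ⟨a ∘ₗ π'.toLinearMap, b ∘ₗ π'.toLinearMap, ?_, fun u v => ?_, fun u v => ?_, ?_, ?_, ?_,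
    fun h0 => hbp' ?_⟩
  · change a (π 1) = 1
    rw [map_one, ha1]
  · change a (π (u * v)) = a (π u) * a (π v)
    rw [map_mul, ha]
  · change b (π (u * v)) = b (π u) * Coalgebra.counit v + a (π u) * b (π v)
    rw [map_mul, hb]
    congr 2
    exact CoalgHomClass.counit_comp_apply π v
  · rw [actR_comp_actR, actR_comp_actR, ← actR_smul]
    refine actR_congr π' fun c => ?_
    rw [actR_smul, ← actR_comp_actR, ← actR_comp_actR, LinearMap.smul_apply, map_smul,
      LinearMap.comp_apply, LinearMap.comp_apply]
    simp only [map_actR]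
    exact LinearMap.congr_fun hab (π' c)
  · obtain ⟨ψ, hψ⟩ := exists_actR_pow (a ∘ₗ π'.toLinearMap) p
    have h1 : (1 : H →ₗ[k] H) = actR Coalgebra.counit := by rw [actR_counit]; rfl
    rw [hψ, h1]
    refine actR_congr π' fun c => ?_
    rw [← hψ, ← h1, map_actR_pow, hap]
    rfl
  · obtain ⟨ψ, hψ⟩ := exists_actR_pow (b ∘ₗ π'.toLinearMap) p
    rw [hψ, ← actR_zero]
    refine actR_congr π' fun c => ?_
    rw [← hψ, actR_zero, map_actR_pow, hbp, LinearMap.zero_apply, LinearMap.zero_apply, map_zero]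
  · ext c
    obtain ⟨h, rfl⟩ := hπ c
    rw [← hπ', ← map_actR_pow, h0]
    simp

end TaftQuotient

section Hopf

variable {k H : Type*} [Field k] [Ring H] [HopfAlgebra k H]

/-- The Galois map `u ⊗ v ↦ u₁ ⊗ u₂ v` of a bialgebra. -/
noncomputable def galoisMap (k H : Type*) [Field k] [Ring H] [Bialgebra k H] :
    H ⊗[k] H →ₗ[k] H ⊗[k] H :=
  (LinearMap.mul' k H).lTensor H ∘ₗ (TensorProduct.assoc k H H H).toLinearMap ∘ₗ
    (comulL k H).rTensor H

lemma galoisMap_tmul (u v : H) :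
    galoisMap k H (u ⊗ₜ v) = (LinearMap.mulRight k v).lTensor H (comulL k H u) := by
  simp only [galoisMap, LinearMap.comp_apply, LinearMap.rTensor_tmul, LinearEquiv.coe_coe]
  induction comulL k H u with
  | zero => simp
  | add x y hx hy => simp only [TensorProduct.add_tmul, map_add, hx, hy]
  | tmul x y => simp

lemma galoisMap_injective : Function.Injective (galoisMap k H) := by
  let θ' : H ⊗[k] H →ₗ[k] H ⊗[k] H :=
    (LinearMap.mul' k H).lTensor H ∘ₗ (TensorProduct.assoc k H H H).toLinearMap ∘ₗ
      ((HopfAlgebra.antipode k).lTensor H ∘ₗ comulL k H).rTensor H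
  suffices h : θ' ∘ₗ galoisMap k H = LinearMap.id from
    Function.LeftInverse.injective (g := θ') fun t => LinearMap.congr_fun h t
  refine TensorProduct.ext' fun u v => ?_
  let K : H ⊗[k] H →ₗ[k] H := LinearMap.mulRight k v ∘ₗ LinearMap.mul' k H ∘ₗ
    (HopfAlgebra.antipode k).rTensor H
  have h1 : ∀ s : H ⊗[k] H, θ' ((LinearMap.mulRight k v).lTensor H s) =
      K.lTensor H (TensorProduct.assoc k H H H ((comulL k H).rTensor H s)) := by
    intro s
    induction s with
    | zero => simp
    | add x y hx hy => simp only [map_add, hx, hy]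
    | tmul x y =>
      simp only [θ', LinearMap.lTensor_tmul, LinearMap.comp_apply, LinearMap.rTensor_tmul,
        LinearEquiv.coe_coe]
      induction comulL k H x with
      | zero => simp
      | add x y hx hy => simp only [TensorProduct.add_tmul, map_add, hx, hy]
      | tmul a b => simp [K, mul_assoc]
  have h2 : K ∘ₗ comulL k H = LinearMap.toSpanSingleton k H v ∘ₗ Coalgebra.counit := by
    ext c
    have := HopfAlgebra.mul_antipode_rTensor_comul_apply (R := k) c
    simp [K, this, Algebra.smul_def]
  have h3 : ∀ s : H ⊗[k] H, (LinearMap.toSpanSingleton k H v).lTensor H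
      ((Coalgebra.counit (R := k)).lTensor H s) =
      TensorProduct.rid k H ((Coalgebra.counit (R := k)).lTensor H s) ⊗ₜ v := by
    intro s
    induction s with
    | zero => simp
    | add x y hx hy => simp only [map_add, hx, hy, TensorProduct.add_tmul]
    | tmul x y => simp [TensorProduct.smul_tmul]
  rw [LinearMap.comp_apply, galoisMap_tmul, h1, Coalgebra.coassoc_apply, ← LinearMap.comp_apply,
    ← LinearMap.lTensor_comp, h2, LinearMap.lTensor_comp, LinearMap.comp_apply, h3]
  simp

/-- The operator of a skew-primitive functional `b` on a Hopf algebra `H` with `b ^ p = 0` and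
`b ^ (p - 1) ≠ 0` has a kernel of dimension at most `dim H / p`. -/
lemma finrank_ker_actR_mul_le [FiniteDimensional k H] {p : ℕ} (hp : 0 < p)
    {a b : Module.Dual k H} (hb : ∀ u v, b (u * v) = b u * Coalgebra.counit v + a u * b v)
    (hap : actR a ^ p = 1) (hbp : actR b ^ p = 0) (hbp' : actR b ^ (p - 1) ≠ 0) :
    Module.finrank k (LinearMap.ker (actR b)) * p ≤ Module.finrank k H := by
  refine finrank_ker_mul_le (actR b) (actR a) p hp ?_ hbp hbp' ?_
  · refine Function.LeftInverse.injective (g := (actR a ^ (p - 1) : H →ₗ[k] H)) fun x => ?_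
    rw [← Module.End.mul_apply, ← pow_succ, Nat.sub_add_cancel hp, hap, Module.End.one_apply]
  · refine finrank_mul_finrank_ker_le_finrank_ker (actR b) galoisMap_injective ?_
    refine TensorProduct.ext' fun u v => ?_
    have hX : ∀ u v, actR b (u * v) = actR b u * v + actR a u * actR b v := fun u v => by
      simpa [actR_counit] using actR_mul_of_apply_mul hb u v
    rw [LinearMap.comp_apply, LinearMap.comp_apply, skewTensor_tmul, map_add]
    simp only [galoisMap_tmul, comul_actR]
    induction comulL k H u with
    | zero => simp
    | add x y hx hy =>
      simp only [map_add, ← hx, ← hy]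
      abel
    | tmul x y => simp [hX, TensorProduct.tmul_add]

end Hopf

section Subalgebra

variable {k H : Type*} [Field k] [Ring H] [Bialgebra k H]

lemma actR_mem_adjoin {g x : H} (hg : IsGrouplikeWrt k (comulL k H) g)
    (hx : CoalgebraStruct.comul (R := k) x = x ⊗ₜ[k] (1 : H) + g ⊗ₜ[k] x)
    (φ : Module.Dual k H) {t : H} (ht : t ∈ Algebra.adjoin k {g, x}) :
    actR φ t ∈ Algebra.adjoin k {g, x} := by
  set T := Algebra.adjoin k {g, x} with hT
  let R := (Algebra.TensorProduct.map T.val (AlgHom.id k H)).range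
  have hgT : g ∈ T := Algebra.subset_adjoin (by simp)
  have hxT : x ∈ T := Algebra.subset_adjoin (by simp)
  have hle : T ≤ R.comap (Bialgebra.comulAlgHom k H) := by
    refine Algebra.adjoin_le ?_
    rintro y (rfl | rfl)
    · exact ⟨⟨_, hgT⟩ ⊗ₜ y, by simpa using hg.2.symm⟩
    · exact ⟨⟨_, hxT⟩ ⊗ₜ 1 + ⟨_, hgT⟩ ⊗ₜ y, by simpa using hx.symm⟩
  obtain ⟨s, hs⟩ := hle ht
  have hs' : comulL k H t = Algebra.TensorProduct.map T.val (AlgHom.id k H) s := hs.symm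
  rw [actR_apply, hs']
  clear hs hs'
  induction s with
  | zero => simp
  | add x y hx hy => simpa only [map_add] using T.add_mem hx hy
  | tmul x y => simpa using T.smul_mem x.2 _

end Subalgebra

section SimpleSubcoalgebra

variable {k H : Type*} [Field k] [Ring H] [Bialgebra k H]

/-- If `actR b` is nilpotent and commutes with `actR a` up to a scalar, then every nonzero
subcoalgebra contains an eigenvector of `actR a` annihilated by `actR b`. -/
lemma IsSubcoalgWrt.exists_eigenvector [IsAlgClosed k] [FiniteDimensional k H]
    {D : Submodule k H} (hD : IsSubcoalgWrt k (comulL k H) D) (hD0 : D ≠ ⊥)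
    {a b : Module.Dual k H} {q : k} (hab : actR a ∘ₗ actR b = q • actR b ∘ₗ actR a) (hq : q ≠ 0)
    {p : ℕ} (hb : actR b ^ p = 0) :
    ∃ μ : k, D ⊓ (LinearMap.ker (actR b) ⊓ Module.End.eigenspace (actR a) μ) ≠ ⊥ := by
  have hK : D ⊓ LinearMap.ker (actR b) ≠ ⊥ := by
    intro h0
    have hinj : ∀ n : ℕ, ∀ d ∈ D, (actR b ^ n) d = 0 → d = 0 := by
      intro n
      induction n with
      | zero => intro d _ h; simpa using h
      | succ n ih =>
        intro d hd h
        rw [pow_succ, Module.End.mul_apply] at h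
        have h1 : d ∈ D ⊓ LinearMap.ker (actR b) := ⟨hd, ih _ (hD.actR_mem b hd) h⟩
        simpa [h0] using h1
    exact hD0 ((Submodule.eq_bot_iff _).2 fun d hd => hinj p d hd (by simp [hb]))
  have hinv : ∀ d ∈ D ⊓ LinearMap.ker (actR b), actR a d ∈ D ⊓ LinearMap.ker (actR b) := by
    rintro d ⟨hd, hd'⟩
    refine ⟨hD.actR_mem a hd, ?_⟩
    have h := LinearMap.congr_fun hab d
    rw [LinearMap.comp_apply, LinearMap.mem_ker.1 hd', map_zero] at h
    exact LinearMap.mem_ker.2 ((smul_eq_zero.1 h.symm).resolve_left hq)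
  have : Nontrivial ↥(D ⊓ LinearMap.ker (actR b)) := Submodule.nontrivial_iff_ne_bot.2 hK
  obtain ⟨μ, hμ⟩ := Module.End.exists_eigenvalue ((actR a).restrict hinv)
  obtain ⟨v, hv⟩ := hμ.exists_hasEigenvector
  refine ⟨μ, fun h0 => hv.2 ?_⟩
  have hv1 : actR a (v : H) = μ • (v : H) := congr_arg Subtype.val hv.apply_eq_smul
  have h1 : (v : H) ∈ D ⊓ (LinearMap.ker (actR b) ⊓ Module.End.eigenspace (actR a) μ) :=
    ⟨v.2.1, v.2.2, Module.End.mem_eigenspace_iff.2 hv1⟩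
  rw [h0] at h1
  exact Subtype.ext ((Submodule.mem_bot k).1 h1)

end SimpleSubcoalgebra

end HopfClass

open HopfClass in
/-- Let `p` be an odd prime and `H` a nonsemisimple, nonpointed, non-copointed Hopf algebra of
dimension `p³` that contains a sub-Hopf algebra `T` isomorphic to a Taft algebra `T_{q′}` of
dimension `p²` and admits a surjective Hopf algebra map `π : H → T_q` onto a Taft algebra of
dimension `p²`. Then `H` contains no simple subcoalgebra of dimension `p²`. -/
theorem no_simple_p_squared_dim_subcoalgebra
    (k : Type*) [Field k] [IsAlgClosed k] [CharZero k]
    (H : Type*) [Ring H] [HopfAlgebra k H] [FiniteDimensional k H]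
    (p : ℕ) (hp : p.Prime) (hodd : Odd p)
    (hdim : Module.finrank k H = p ^ 3)
    (hnss : ¬ IsSemisimpleRing H) (hnp : ¬ IsPointed k H) (hncop : ¬ IsCopointed k H)
    (q' : k) (T : Subalgebra k H) (hT : IsTaftSubalgebra k p q' T)
    (q : k) (B : Type*) [Ring B] [HopfAlgebra k B]
    (hB : IsTaftAlgebra k p q B)
    (π : H →ₐc[k] B) (hsurj : Function.Surjective π) :
    ¬ ∃ D : Submodule k H, IsSimpleSubcoalgWrt k (comulL k H) D ∧
      Module.finrank k ↥D = p ^ 2 := by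
  rintro ⟨D, hD, hDdim⟩
  obtain ⟨a, b, ha1, ha, hb, hab, hap, hbp, hbp'⟩ :=
    hB.exists_functionals_of_surjective hp.one_lt π hsurj
  have hq1 : q ≠ 1 := hB.1.ne_one hp.one_lt
  have hq0 : q ≠ 0 := hB.1.ne_zero hp.ne_zero
  obtain ⟨hq', hTdim, g, x, hg, hx, hgp, -, hgx, hgen⟩ := hT
  have hq'1 : q' ≠ 1 := hq'.ne_one hp.one_lt
  have : Nontrivial H := ⟨g, 0, hg.1⟩
  have hA : ∀ u v, actR a (u * v) = actR a u * actR a v := fun u v => by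
    simpa [actR_zero] using actR_mul_of_apply_mul (φ₃ := 0) (φ₄ := 0)
      (fun u v => by simpa using ha u v) u v
  have hX : ∀ u v, actR b (u * v) = actR b u * v + actR a u * actR b v := fun u v => by
    simpa [actR_counit] using actR_mul_of_apply_mul hb u v
  have hb1 : b 1 = 0 := by simpa [ha1] using hb 1 1
  have hker : Module.finrank k (LinearMap.ker (actR b)) ≤ p ^ 2 := by
    have h := finrank_ker_actR_mul_le hp.pos hb hap hbp hbp'
    rw [hdim, pow_succ] at h
    exact Nat.le_of_mul_le_mul_right h hp.pos
  have hnot : ∀ n : ℕ, g ^ n ∉ D := fun n =>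
    hD.notMem_of_grouplike (by rw [hDdim]; exact (Nat.one_lt_pow two_ne_zero hp.one_lt).ne')
      (isGrouplikeWrt_pow hg n)
  set ω : k := a g with hω
  have hapow : ∀ n : ℕ, a (g ^ n) = ω ^ n := by
    intro n
    induction n with
    | zero => simpa using ha1
    | succ n ih => rw [pow_succ, ha, ih, pow_succ]
  have hωp : ω ^ p = 1 := by rw [← hapow, hgp, ha1]
  have hω0 : ω ≠ 0 := by
    rintro h
    rw [h, zero_pow hp.ne_zero] at hωp
    exact zero_ne_one hωp
  have hbg : b g = 0 := by
    have h := LinearMap.congr_fun hab g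
    simp only [LinearMap.comp_apply, LinearMap.smul_apply, actR_grouplike _ hg, map_smul,
      smul_smul, ← hω] at h
    have h2 : ((1 - q) * (b g * ω)) • g = 0 := by
      rw [one_sub_mul, sub_smul, h, sub_eq_zero]
      congr 1
      ring
    have h3 := (smul_eq_zero.1 h2).resolve_right hg.1
    exact (mul_eq_zero.1 ((mul_eq_zero.1 h3).resolve_left (sub_ne_zero.2 hq1.symm))).resolve_right
      hω0
  have hXpow : ∀ n : ℕ, actR b (g ^ n) = 0 := by
    intro n
    induction n with
    | zero => rw [pow_zero, actR_one, hb1, zero_smul]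
    | succ n ih => rw [pow_succ, hX, ih, actR_grouplike b hg, hbg, zero_smul, zero_mul, mul_zero,
        add_zero]
  have hApow : ∀ n : ℕ, actR a (g ^ n) = ω ^ n • g ^ n := fun n => by
    rw [actR_grouplike a (isGrouplikeWrt_pow hg n), hapow]
  obtain ⟨μ, hY⟩ := hD.1.exists_eigenvector hD.2.1 hab hq0 hbp
  let E : k → Submodule k H := fun ν =>
    LinearMap.ker (actR b) ⊓ Module.End.eigenspace (actR a) ν
  have hmemE : ∀ ν u, u ∈ E ν ↔ actR b u = 0 ∧ actR a u = ν • u := fun ν u => by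
    simp only [E, Submodule.mem_inf, LinearMap.mem_ker, Module.End.mem_eigenspace_iff]
  set Y : Submodule k H := D ⊓ E μ with hYdef
  have hYL : ∀ φ : Module.Dual k H, ∀ y ∈ Y, actL φ y ∈ Y := by
    rintro φ y ⟨hyD, hyE⟩
    rw [SetLike.mem_coe, hmemE] at hyE
    refine ⟨hD.1.actL_mem φ hyD, (hmemE _ _).2 ⟨?_, ?_⟩⟩
    · rw [← actL_actR, hyE.1, map_zero]
    · rw [← actL_actR, hyE.2, map_smul]
  obtain ⟨hYdim, hYgen⟩ := hD.of_left_coideal inf_le_left hY hYL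
  have hYp : p ≤ Module.finrank k Y := by
    rw [hDdim] at hYdim
    exact (Nat.pow_le_pow_iff_left two_ne_zero).1 hYdim
  have hsum := sum_finrank_inf_eigenspace_le (actR a) (LinearMap.ker (actR b))
  by_cases hω1 : ω = 1
  · have hbx : b x = 0 := by
      have h1 := hb g x
      have h2 := hb x g
      rw [hgx, map_smul, h2, hbg, ← hω, hω1, counit_grouplike hg] at h1
      simp only [mul_one, mul_zero, add_zero, zero_mul, zero_add, one_mul, smul_eq_mul] at h1
      have h3 : (q' - 1) * b x = 0 := by rw [sub_mul, h1, one_mul, sub_self]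
      exact (mul_eq_zero.1 h3).resolve_left (sub_ne_zero.2 hq'1)
    have hTX : Subalgebra.toSubmodule T ≤ LinearMap.ker (actR b) := by
      intro t ht
      rw [LinearMap.mem_ker]
      rw [Subalgebra.mem_toSubmodule, ← hgen] at ht
      induction ht using Algebra.adjoin_induction with
      | mem y hy =>
        rcases hy with rfl | rfl
        · rw [actR_grouplike b hg, hbg, zero_smul]
        · rw [actR_skewPrimitive b hx, hb1, hbx, zero_smul, zero_smul, add_zero]
      | algebraMap r =>
        rw [Algebra.algebraMap_eq_smul_one, map_smul, actR_one, hb1, zero_smul, smul_zero]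
      | add u v _ _ hu hv => rw [map_add, hu, hv, add_zero]
      | mul u v _ _ hu hv => rw [hX, hu, hv, zero_mul, mul_zero, add_zero]
    have hTeq : Subalgebra.toSubmodule T = LinearMap.ker (actR b) :=
      Submodule.eq_of_le_of_finrank_le hTX (hker.trans hTdim.ge)
    have hDT : D ≤ Subalgebra.toSubmodule T := by
      refine hYgen _ fun y hy φ => ?_
      have hyT : y ∈ Subalgebra.toSubmodule T := hTeq ▸ hy.2.1
      rw [Subalgebra.mem_toSubmodule, ← hgen] at hyT ⊢
      exact actR_mem_adjoin hg hx φ hyT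
    have hDeq : D = Subalgebra.toSubmodule T :=
      Submodule.eq_of_le_of_finrank_le hDT (hTdim.trans hDdim.symm).le
    refine hnot 0 ?_
    rw [hDeq, pow_zero]
    exact T.one_mem
  · have hprim : IsPrimitiveRoot ω p := by
      rw [← orderOf_eq_prime (hp := ⟨hp⟩) hωp hω1]
      exact IsPrimitiveRoot.orderOf ω
    have hμ0 : μ ≠ 0 := by
      rintro rfl
      refine hY ((Submodule.eq_bot_iff _).2 fun y hy => ?_)
      have h1 : actR a y = 0 := by simpa using ((hmemE _ _).1 hy.2).2
      have h2 : (actR a ^ p) y = 0 := by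
        rw [← Nat.sub_add_cancel hp.pos, pow_succ, Module.End.mul_apply, h1, map_zero]
      rwa [hap, Module.End.one_apply] at h2
    have hinj : ∀ i : ℕ, Function.Injective (LinearMap.mulLeft k (g ^ i)) := fun i =>
      ((IsUnit.of_pow_eq_one hgp hp.ne_zero).pow i).mul_right_injective
    have hmap : ∀ i : ℕ, Y.map (LinearMap.mulLeft k (g ^ i)) ≤ E (μ * ω ^ i) := by
      rintro i _ ⟨y, hy, rfl⟩
      obtain ⟨h1, h2⟩ := (hmemE _ _).1 hy.2
      rw [hmemE, LinearMap.mulLeft_apply, hX, hA, h1, h2, hXpow, hApow, zero_mul, mul_zero,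
        add_zero, smul_mul_smul_comm, mul_comm μ]
      exact ⟨rfl, rfl⟩
    have hmapdim : ∀ i : ℕ, Module.finrank k (Y.map (LinearMap.mulLeft k (g ^ i))) =
        Module.finrank k Y := fun i =>
      LinearEquiv.finrank_eq (Submodule.equivMapOfInjective _ (hinj i) _).symm
    have hEp : ∀ i : ℕ, p ≤ Module.finrank k (E (μ * ω ^ i)) := fun i =>
      hYp.trans ((hmapdim i).ge.trans (Submodule.finrank_mono (hmap i)))
    have hone : (1 : H) ∈ E 1 := (hmemE _ _).2
      ⟨by simpa using hXpow 0, by simpa using hApow 0⟩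
    classical
    let s : Finset k := (Finset.range p).image fun i => μ * ω ^ i
    have hcard : s.card = p := by
      rw [Finset.card_image_of_injOn, Finset.card_range]
      intro i hi j hj hij
      exact hprim.pow_inj (by simpa using hi) (by simpa using hj) (mul_left_cancel₀ hμ0 hij)
    have hsp : ∀ ν ∈ s, p ≤ Module.finrank k (E ν) := by
      intro ν hν
      obtain ⟨i, -, rfl⟩ := Finset.mem_image.1 hν
      exact hEp i
    have hsum' : p ^ 2 ≤ ∑ ν ∈ s, Module.finrank k (E ν) := by
      have h := Finset.card_nsmul_le_sum s _ _ hsp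
      rwa [hcard, smul_eq_mul, ← sq] at h
    by_cases h1 : (1 : k) ∈ s
    · obtain ⟨i, hi, hi1⟩ := Finset.mem_image.1 h1
      have hip : i < p := Finset.mem_range.1 hi
      have hlt : p < Module.finrank k (E 1) := by
        refine hYp.trans_lt ?_
        rw [← hmapdim i]
        refine Submodule.finrank_lt_finrank_of_lt (lt_of_le_of_ne (hi1 ▸ hmap i) fun heq => ?_)
        rw [← heq] at hone
        obtain ⟨y, hy, hy1⟩ := hone
        have hy2 : y = g ^ (p - i) := by
          rw [LinearMap.mulLeft_apply] at hy1
          rw [← one_mul y, ← hgp, ← Nat.sub_add_cancel hip.le, pow_add, mul_assoc, hy1, mul_one,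
            Nat.sub_add_cancel hip.le]
        exact hnot _ (hy2 ▸ hy.1)
      have h := Finset.sum_lt_sum (f := fun _ => p) hsp ⟨1, h1, hlt⟩
      rw [Finset.sum_const, hcard, smul_eq_mul, ← sq] at h
      exact absurd ((hsum s).trans hker) (not_le.2 h)
    · have h := (hsum (insert 1 s)).trans hker
      rw [Finset.sum_insert h1] at h
      have hpos : 0 < Module.finrank k (E 1) := by
        have : Nontrivial (E 1) := ⟨⟨1, hone⟩, 0, fun h => one_ne_zero (congr_arg Subtype.val h)⟩
        exact Module.finrank_pos
      have h2 := add_lt_add_of_lt_of_le hpos hsum'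
      rw [zero_add] at h2
      exact absurd h (not_le.2 h2)
end
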